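/- arXiv:1304.4813 — 3 statements merged into one kernel-verified Lean document; each statement's English description precedes it below -/
import Mathlib

section
/- Let σ be a 2-pattern of length r with first letter σ₁ = 2, and for 0 ≤ j ≤ r set p_j(n) = ((−1)^{r−j}/2^{r−j+1})·(C(n,j) + (1/2)·C(n,j−1)), with the convention C(n,−1) = 0. Then for every integer n ≥ r one has the identity (in ℚ): Σ_{π ∈ Π_n} occ_σ(π) = Σ_{j=0}^{r} p_j(n)·B_{n+2−j} − (1/2)·C(n,r)·B_{n+1−r} + ((−1)^{r+1}/2^{r+1})·B_n. -/
open scoped Classical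

def seg (n : ℕ) : Finset ℕ := Finset.Icc 1 n

def IsPartition (P : Finset (Finset ℕ)) (S : Finset ℕ) : Prop :=
  ∅ ∉ P ∧ (∀ B ∈ P, ∀ C ∈ P, B ≠ C → Disjoint B C) ∧ P.biUnion id = S

noncomputable def partitions (n : ℕ) : Finset (Finset (Finset ℕ)) :=
  ((seg n).powerset.powerset).filter fun P => IsPartition P (seg n)

noncomputable def partitionsK (n k : ℕ) : Finset (Finset (Finset ℕ)) :=
  (partitions n).filter fun P => P.card = k

noncomputable def bell (n : ℕ) : ℕ := (partitions n).card

noncomputable def stirling (n k : ℕ) : ℕ := (partitionsK n k).card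

/-- `(i, j)` is an edge of the set partition `P`. -/
def IsEdge (P : Finset (Finset ℕ)) (i j : ℕ) : Prop :=
  i < j ∧ ∃ B ∈ P, i ∈ B ∧ j ∈ B ∧ ∀ p ∈ B, ¬(i < p ∧ p < j)

/-- `crol P`: number of linear crossings. -/
noncomputable def crol (P : Finset (Finset ℕ)) : ℕ :=
  Nat.card {e : (ℕ × ℕ) × ℕ × ℕ //
    IsEdge P e.1.1 e.1.2 ∧ IsEdge P e.2.1 e.2.2 ∧
      e.1.1 < e.2.1 ∧ e.2.1 < e.1.2 ∧ e.1.2 < e.2.2}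

/-- `(i, j)` is a circular edge of `P`. -/
def IsCircEdge (P : Finset (Finset ℕ)) (i j : ℕ) : Prop :=
  IsEdge P i j ∨
    ∃ B ∈ P, ∃ h : B.Nonempty, 2 ≤ B.card ∧ i = B.min' h ∧ j = B.max' h

/-- `croc P`: number of circular crossings. -/
noncomputable def croc (P : Finset (Finset ℕ)) : ℕ :=
  Nat.card {e : (ℕ × ℕ) × ℕ × ℕ //
    IsCircEdge P e.1.1 e.1.2 ∧ IsCircEdge P e.2.1 e.2.2 ∧
      e.1.1 < e.2.1 ∧ e.2.1 < e.1.2 ∧ e.1.2 < e.2.2}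

/-- Two blocks overlap: `min B < min B' < max B < max B'`. -/
def Overlap (B B' : Finset ℕ) : Prop :=
  ∃ (h : B.Nonempty) (h' : B'.Nonempty),
    B.min' h < B'.min' h' ∧ B'.min' h' < B.max' h ∧ B.max' h < B'.max' h'

/-- `ov P`: number of (unordered) pairs of blocks of `P` that overlap. -/
noncomputable def ov (P : Finset (Finset ℕ)) : ℕ :=
  Nat.card {p : Finset ℕ × Finset ℕ // p.1 ∈ P ∧ p.2 ∈ P ∧ Overlap p.1 p.2}

/-- Two blocks embrace: `min B < min B' ≤ max B' < max B`. -/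
def Embrace (B B' : Finset ℕ) : Prop :=
  ∃ (h : B.Nonempty) (h' : B'.Nonempty),
    B.min' h < B'.min' h' ∧ B'.min' h' ≤ B'.max' h' ∧ B'.max' h' < B.max' h

noncomputable def emb (P : Finset (Finset ℕ)) : ℕ :=
  Nat.card {p : Finset ℕ × Finset ℕ // p.1 ∈ P ∧ p.2 ∈ P ∧ Embrace p.1 p.2}

/-- The block of `P` containing `i`. -/
noncomputable def blockOf (P : Finset (Finset ℕ)) (i : ℕ) : Finset ℕ :=
  (P.filter fun B => i ∈ B).biUnion id

/-- The restricted growth function of `P`: `rgf P i = j` iff `i` lies in the `j`-th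
block of `P`, the blocks being ordered by increasing minima. -/
noncomputable def rgf (P : Finset (Finset ℕ)) (i : ℕ) : ℕ :=
  (P.filter fun B => B.min ≤ (blockOf P i).min).card

/-- A 2-pattern: a word on `{1,2}` containing both letters. -/
def TwoPattern {r : ℕ} (σ : Fin r → ℕ) : Prop :=
  (∀ t, σ t = 1 ∨ σ t = 2) ∧ (∃ t, σ t = 1) ∧ (∃ t, σ t = 2)

/-- `occ n σ P`: number of occurrences of the 2-pattern `σ` in the partition `P` of `[n]`. -/
noncomputable def occ (n : ℕ) {r : ℕ} (σ : Fin r → ℕ) (P : Finset (Finset ℕ)) : ℕ :=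
  Nat.card {i : Fin r → ℕ // StrictMono i ∧ (∀ t, i t ∈ seg n) ∧
    ∃ a b : ℕ, a < b ∧
      ∀ t, (σ t = 1 → rgf P (i t) = a) ∧ (σ t = 2 → rgf P (i t) = b)}

/-- Carlitz `q`-Stirling polynomials. -/
noncomputable def qS : ℕ → ℕ → Polynomial ℚ
  | 0, 0 => 1
  | 0, _ + 1 => 0
  | _ + 1, 0 => 0
  | n + 1, k + 1 =>
      Polynomial.X ^ k * qS n k +
        (∑ i ∈ Finset.range (k + 1), Polynomial.X ^ i) * qS n (k + 1)

/-- Standardization: the order preserving bijection `S → [|S|]`. -/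
def stdMap (S : Finset ℕ) (a : ℕ) : ℕ := (S.filter fun x => x ≤ a).card

/-- The standardized 2-block partition obtained from two blocks `A, B`. -/
def stdPair (A B : Finset ℕ) : Finset (Finset ℕ) :=
  {A.image (stdMap (A ∪ B)), B.image (stdMap (A ∪ B))}

open Finset in
/-- Binomial transform applied twice. -/
theorem sum_choose_mul_sum_choose_mul (f : ℕ → ℕ) (m : ℕ) :
    ∑ i ∈ range (m + 1), m.choose i * ∑ k ∈ range (i + 1), i.choose k * f k
      = ∑ k ∈ range (m + 1), m.choose k * 2 ^ (m - k) * f k := by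
  have key : ∀ A : Finset ℕ, ∑ k ∈ range (#A + 1), (#A).choose k * f k
      = ∑ C ∈ A.powerset, f #C := fun A => by
    rw [sum_powerset_apply_card]; simp
  have h := sum_powerset_apply_card (fun i => ∑ k ∈ range (i + 1), i.choose k * f k) (x := range m)
  simp only [card_range, smul_eq_mul] at h
  rw [← h]
  simp only [key]
  have h2 := sum_powerset_apply_card (fun k => 2 ^ (m - k) * f k) (x := range m)
  simp only [card_range, smul_eq_mul, ← mul_assoc] at h2
  rw [← h2, sum_comm' (t' := (range m).powerset) (s' := fun C => Icc C (range m))]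
  · refine sum_congr rfl fun C hC => ?_
    rw [sum_const, card_Icc_finset (mem_powerset.1 hC), card_range, smul_eq_mul]
  · intro A C
    simp only [mem_powerset, mem_Icc]
    exact ⟨fun h => ⟨⟨h.2, h.1⟩, h.2.trans h.1⟩, fun h => ⟨h.1.2, h.1.1⟩⟩

open Finset in
theorem nat_bell_succ_range (m : ℕ) :
    Nat.bell (m + 1) = ∑ i ∈ range (m + 1), m.choose i * Nat.bell i := by
  rw [Nat.bell_succ', Nat.sum_antidiagonal_eq_sum_range_succ
    (fun i j => m.choose i * Nat.bell j), ← sum_range_reflect]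
  refine sum_congr rfl fun i hi => ?_
  have hi : i ≤ m := by simpa [Nat.lt_succ_iff] using hi
  rw [show m + 1 - 1 - i = m - i by omega, Nat.choose_symm hi, Nat.sub_sub_self hi]

open Finset in
theorem sum_choose_two_pow_bell (m : ℕ) :
    ∑ u ∈ range (m + 1), m.choose u * 2 ^ u * Nat.bell (m - u) + Nat.bell (m + 1)
      = Nat.bell (m + 2) := by
  have h := sum_choose_mul_sum_choose_mul Nat.bell m
  simp only [← nat_bell_succ_range] at h
  have hsplit : ∑ i ∈ range (m + 1), m.choose (i + 1) * Nat.bell (i + 1) + Nat.bell 0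
      = Nat.bell (m + 1) := by
    rw [nat_bell_succ_range m, ← add_zero (∑ i ∈ range (m + 1), m.choose i * Nat.bell i),
      show 0 = m.choose (m + 1) * Nat.bell (m + 1) by simp,
      ← sum_range_succ, sum_range_succ' _ (m + 1)]
    simp
  rw [nat_bell_succ_range (m + 1), sum_range_succ' (fun i => (m + 1).choose i * Nat.bell i)]
  simp only [Nat.choose_succ_succ', add_mul, sum_add_distrib, h, Nat.choose_zero_right, one_mul]
  rw [add_assoc, hsplit, ← sum_range_reflect]
  congr 1
  refine sum_congr rfl fun i hi => ?_
  have hi : i ≤ m := by simpa [Nat.lt_succ_iff] using hi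
  rw [show m + 1 - 1 - i = m - i by omega, Nat.choose_symm hi, Nat.sub_sub_self hi]

/-- The total number of occurrences, over the set partitions of `[n]`, of a 2-pattern of
length `r` with first letter 2: in the summand, `k + 1` is the size of the union of the two blocks
involved. -/
def occSum (n r : ℕ) : ℕ :=
  ∑ k ∈ Finset.range n, n.choose (k + 1) * (k.choose r * 2 ^ (k - r)) * Nat.bell (n - (k + 1))

open Finset in
theorem two_mul_occSum_zero_add_bell_add_bell (n : ℕ) :
    2 * occSum n 0 + Nat.bell n + Nat.bell (n + 1) = Nat.bell (n + 2) := by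
  rw [← sum_choose_two_pow_bell n, sum_range_succ', occSum, mul_sum]
  simp only [Nat.choose_zero_right, one_mul, pow_zero, Nat.sub_zero]
  congr 2
  refine sum_congr rfl fun k _ => ?_
  rw [pow_succ]
  ring

open Finset in
theorem two_mul_occSum_succ_add_occSum (n r : ℕ) (h : r + 1 ≤ n) :
    2 * occSum n (r + 1) + occSum n r + n.choose (r + 1) * Nat.bell (n - r)
      = n.choose (r + 1) * Nat.bell (n - r + 1) := by
  obtain ⟨d, rfl⟩ := Nat.exists_eq_add_of_le h
  rw [show r + 1 + d - r = d + 1 by omega, ← sum_choose_two_pow_bell d, mul_add]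
  congr 1
  rw [occSum, occSum, mul_sum, ← sum_add_distrib, mul_sum, show r + 1 + d = r + (d + 1) by omega,
    sum_range_add, sum_eq_zero, zero_add]
  · refine sum_congr rfl fun u _ => ?_
    have hc := Nat.choose_mul (n := r + (d + 1)) (k := r + u + 1) (s := r + 1)
      (by omega)
    rw [show r + (d + 1) - (r + 1) = d by omega, show r + u + 1 - (r + 1) = u by omega] at hc
    rw [show r + u - r = u by omega, show r + (d + 1) - (r + u + 1) = d - u by omega,
      ← mul_assoc ((r + (d + 1)).choose (r + 1)), ← mul_assoc ((r + (d + 1)).choose (r + 1)), ← hc,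
      Nat.choose_succ_succ' (r + u) r]
    rcases u with _ | u
    · simp
    · rw [show r + (u + 1) - (r + 1) = u by omega, pow_succ]
      ring
  · intro k hk
    have hk := mem_range.1 hk
    simp [Nat.choose_eq_zero_of_lt hk, Nat.choose_eq_zero_of_lt (hk.trans (Nat.lt_succ_self r))]

open Finset in
theorem occSum_eq (n r : ℕ) (h : r ≤ n) :
    (occSum n r : ℚ) = (∑ j ∈ range (r + 1),
          ((-1 : ℚ) ^ (r - j) / 2 ^ (r - j + 1)) *
              ((n.choose j : ℚ) + (1 / 2) * (if j = 0 then 0 else (n.choose (j - 1) : ℚ)))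
            * (Nat.bell (n + 2 - j) : ℚ))
        - (1 / 2) * (n.choose r : ℚ) * (Nat.bell (n + 1 - r) : ℚ)
        + ((-1 : ℚ) ^ (r + 1) / 2 ^ (r + 1)) * (Nat.bell n : ℚ) := by
  induction r with
  | zero =>
    have := congrArg (Nat.cast (R := ℚ)) (two_mul_occSum_zero_add_bell_add_bell n)
    push_cast at this
    simp
    linarith
  | succ r ih =>
    have h1 := congrArg (Nat.cast (R := ℚ)) (two_mul_occSum_succ_add_occSum n r h)
    push_cast at h1
    have hs : ∑ j ∈ range (r + 1), ((-1 : ℚ) ^ (r + 1 - j) / 2 ^ (r + 1 - j + 1)) *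
              ((n.choose j : ℚ) + (1 / 2) * (if j = 0 then 0 else (n.choose (j - 1) : ℚ)))
            * (Nat.bell (n + 2 - j) : ℚ)
        = (-1 / 2) * ∑ j ∈ range (r + 1), ((-1 : ℚ) ^ (r - j) / 2 ^ (r - j + 1)) *
              ((n.choose j : ℚ) + (1 / 2) * (if j = 0 then 0 else (n.choose (j - 1) : ℚ)))
            * (Nat.bell (n + 2 - j) : ℚ) := by
      rw [mul_sum]
      refine sum_congr rfl fun j hj => ?_
      have hj := mem_range.1 hj
      rw [show r + 1 - j = r - j + 1 by omega, pow_succ (-1 : ℚ), pow_succ _ (r - j + 1)]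
      ring
    rw [sum_range_succ, hs]
    have ih := ih (by omega)
    rw [show n + 2 - (r + 1) = n - r + 1 by omega, show n + 1 - (r + 1) = n - r by omega]
    rw [show n + 1 - r = n - r + 1 by omega] at ih
    simp only [Nat.sub_self, pow_zero, zero_add, pow_one, Nat.add_sub_cancel,
      Nat.succ_ne_zero, if_false, pow_succ (-1 : ℚ) (r + 1), pow_succ (2 : ℚ) (r + 1)]
    have e : (-1 : ℚ) ^ (r + 1) * -1 / (2 ^ (r + 1) * 2)
      = (-1 / 2) * ((-1 : ℚ) ^ (r + 1) / 2 ^ (r + 1)) := by ring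
    rw [e]
    linear_combination (1 / 2) * h1 - (1 / 2) * ih

/-- The set partitions of a finite set `S`. -/
noncomputable def partitionsOf (S : Finset ℕ) : Finset (Finset (Finset ℕ)) :=
  (S.powerset.powerset).filter fun P => IsPartition P S

theorem IsPartition.subset {P : Finset (Finset ℕ)} {S A : Finset ℕ} (h : IsPartition P S)
    (hA : A ∈ P) : A ⊆ S := by
  rw [← h.2.2]
  exact Finset.subset_biUnion_of_mem id hA

theorem IsPartition.nonempty {P : Finset (Finset ℕ)} {S A : Finset ℕ} (h : IsPartition P S)
    (hA : A ∈ P) : A.Nonempty :=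
  Finset.nonempty_iff_ne_empty.2 fun e => h.1 (e ▸ hA)

theorem IsPartition.eq_of_mem {P : Finset (Finset ℕ)} {S A B : Finset ℕ} {x : ℕ}
    (h : IsPartition P S) (hA : A ∈ P) (hB : B ∈ P) (hxA : x ∈ A) (hxB : x ∈ B) : A = B := by
  by_contra hne
  exact Finset.disjoint_left.1 (h.2.1 A hA B hB hne) hxA hxB

theorem IsPartition.exists_mem {P : Finset (Finset ℕ)} {S : Finset ℕ} {x : ℕ}
    (h : IsPartition P S) (hx : x ∈ S) : ∃ A ∈ P, x ∈ A := by
  rw [← h.2.2] at hx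
  simpa using hx

theorem mem_partitionsOf {P : Finset (Finset ℕ)} {S : Finset ℕ} :
    P ∈ partitionsOf S ↔ IsPartition P S := by
  simp only [partitionsOf, Finset.mem_filter, Finset.mem_powerset, and_iff_right_iff_imp]
  exact fun h A hA => Finset.mem_powerset.2 (h.subset hA)

theorem IsPartition.erase {P : Finset (Finset ℕ)} {S A : Finset ℕ} (h : IsPartition P S)
    (hA : A ∈ P) : IsPartition (P.erase A) (S \ A) := by
  refine ⟨fun h0 => h.1 (Finset.mem_of_mem_erase h0), fun B hB C hC =>
    h.2.1 B (Finset.mem_of_mem_erase hB) C (Finset.mem_of_mem_erase hC), ?_⟩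
  ext x
  simp only [Finset.mem_biUnion, Finset.mem_erase, id, Finset.mem_sdiff]
  constructor
  · rintro ⟨B, ⟨hne, hB⟩, hx⟩
    exact ⟨h.subset hB hx, fun hxA => hne (h.eq_of_mem hB hA hx hxA)⟩
  · rintro ⟨hx, hxA⟩
    obtain ⟨B, hB, hxB⟩ := h.exists_mem hx
    exact ⟨B, ⟨fun e => hxA (e ▸ hxB), hB⟩, hxB⟩

theorem IsPartition.notMem_of_sdiff {P : Finset (Finset ℕ)} {S A : Finset ℕ}
    (h : IsPartition P (S \ A)) (hA : A.Nonempty) : A ∉ P := fun hP => by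
  obtain ⟨x, hx⟩ := hA
  exact (Finset.mem_sdiff.1 (h.subset hP hx)).2 hx

theorem IsPartition.insert {P : Finset (Finset ℕ)} {S A : Finset ℕ} (h : IsPartition P (S \ A))
    (hA : A.Nonempty) (hAS : A ⊆ S) : IsPartition (insert A P) S := by
  have hd : ∀ B ∈ P, Disjoint B A := fun B hB =>
    Finset.disjoint_of_subset_left (h.subset hB) Finset.sdiff_disjoint
  refine ⟨fun h0 => ?_, fun B hB C hC hne => ?_, ?_⟩
  · rcases Finset.mem_insert.1 h0 with e | h0
    · exact hA.ne_empty e.symm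
    · exact h.1 h0
  · rcases Finset.mem_insert.1 hB with rfl | hB' <;>
      rcases Finset.mem_insert.1 hC with rfl | hC'
    · exact absurd rfl hne
    · exact (hd C hC').symm
    · exact hd B hB'
    · exact h.2.1 B hB' C hC' hne
  · rw [Finset.biUnion_insert, h.2.2, id, Finset.union_sdiff_of_subset hAS]

/-- Summing over a partition together with one of its blocks amounts to summing over the block
and a partition of its complement. -/
theorem sum_partitionsOf_sum_block (S : Finset ℕ) (f : Finset ℕ → Finset (Finset ℕ) → ℕ) :
    ∑ P ∈ partitionsOf S, ∑ A ∈ P, f A (P.erase A)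
      = ∑ A ∈ S.powerset.erase ∅, ∑ P ∈ partitionsOf (S \ A), f A P := by
  rw [Finset.sum_sigma', Finset.sum_sigma']
  refine Finset.sum_bij' (fun x _ => ⟨x.2, x.1.erase x.2⟩) (fun x _ => ⟨insert x.1 x.2, x.1⟩)
    ?_ ?_ ?_ ?_ ?_
  · rintro ⟨P, A⟩ h
    obtain ⟨hP, hA⟩ := Finset.mem_sigma.1 h
    have hP := mem_partitionsOf.1 hP
    simp only [Finset.mem_sigma, Finset.mem_erase, Finset.mem_powerset, mem_partitionsOf]
    exact ⟨⟨(hP.nonempty hA).ne_empty, hP.subset hA⟩, hP.erase hA⟩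
  · rintro ⟨A, P⟩ h
    simp only [Finset.mem_sigma, Finset.mem_erase, Finset.mem_powerset, mem_partitionsOf] at h
    simp only [Finset.mem_sigma, mem_partitionsOf]
    exact ⟨h.2.insert (Finset.nonempty_iff_ne_empty.2 h.1.1) h.1.2, Finset.mem_insert_self _ _⟩
  · rintro ⟨P, A⟩ h
    simp [Finset.insert_erase (Finset.mem_sigma.1 h).2]
  · rintro ⟨A, P⟩ h
    simp only [Finset.mem_sigma, Finset.mem_erase, Finset.mem_powerset, mem_partitionsOf] at h
    simp [Finset.erase_insert
      (h.2.notMem_of_sdiff (Finset.nonempty_iff_ne_empty.2 h.1.1))]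
  · rintro ⟨P, A⟩ _
    rfl

theorem partitionsOf_empty : partitionsOf ∅ = {∅} := by
  ext P
  rw [mem_partitionsOf, Finset.mem_singleton]
  constructor
  · intro h
    refine Finset.eq_empty_of_forall_notMem fun A hA => ?_
    obtain ⟨x, hx⟩ := h.nonempty hA
    exact absurd (h.subset hA hx) (Finset.notMem_empty x)
  · rintro rfl
    simp [IsPartition]

theorem card_partitionsOf (S : Finset ℕ) : (partitionsOf S).card = Nat.bell S.card := by
  induction S using Finset.strongInduction with
  | H S ih =>
    rcases S.eq_empty_or_nonempty with rfl | ⟨x, hx⟩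
    · simp [partitionsOf_empty]
    · have h1 : (partitionsOf S).card
          = ∑ P ∈ partitionsOf S, ∑ A ∈ P, if x ∈ A then 1 else 0 := by
        rw [Finset.card_eq_sum_ones]
        refine Finset.sum_congr rfl fun P hP => ?_
        have hP := mem_partitionsOf.1 hP
        obtain ⟨A, hA, hxA⟩ := hP.exists_mem hx
        rw [Finset.sum_eq_single_of_mem A hA fun B hB hne =>
          if_neg fun hxB => hne (hP.eq_of_mem hB hA hxB hxA), if_pos hxA]
      have h2 := sum_partitionsOf_sum_block S fun A _ => if x ∈ A then 1 else 0
      have hcard : S.card = (S.erase x).card + 1 := (Finset.card_erase_add_one hx).symm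
      rw [h1, h2, hcard, Nat.bell_succ, ← Nat.range_succ_eq_Iic]
      have h3 := Finset.sum_powerset_apply_card (fun i => Nat.bell ((S.erase x).card - i))
        (x := S.erase x)
      simp only [smul_eq_mul] at h3
      rw [← h3, ← Finset.sum_subset (s₁ := (S.erase x).powerset.image (insert x))]
      · rw [Finset.sum_image]
        · refine Finset.sum_congr rfl fun A hA => ?_
          have hA := Finset.mem_powerset.1 hA
          have hxA : x ∉ A := fun h => Finset.notMem_erase x S (hA h)
          have hAS : insert x A ⊆ S :=
            Finset.insert_subset hx (hA.trans (Finset.erase_subset x S))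
          simp only [Finset.mem_insert_self, if_true, Finset.sum_const, smul_eq_mul, mul_one]
          rw [ih _ (Finset.sdiff_ssubset hAS (Finset.insert_nonempty x A)),
            Finset.card_sdiff_of_subset hAS, Finset.card_insert_of_notMem hxA, hcard,
            Nat.add_sub_add_right]
        · intro A hA B hB hAB
          have hA := Finset.mem_powerset.1 hA
          have hB := Finset.mem_powerset.1 hB
          rw [← Finset.erase_insert (fun h => Finset.notMem_erase x S (hA h)), hAB,
            Finset.erase_insert (fun h => Finset.notMem_erase x S (hB h))]
      · intro B hB
        obtain ⟨A, hA, rfl⟩ := Finset.mem_image.1 hB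
        exact Finset.mem_erase.2 ⟨Finset.insert_ne_empty x A, Finset.mem_powerset.2
          (Finset.insert_subset hx ((Finset.mem_powerset.1 hA).trans (Finset.erase_subset x S)))⟩
      · intro A hA hA'
        refine Finset.sum_eq_zero fun _ _ => if_neg fun hxA => hA' ?_
        exact Finset.mem_image.2 ⟨A.erase x, Finset.mem_powerset.2 (Finset.erase_subset_erase x
          (Finset.mem_powerset.1 (Finset.mem_of_mem_erase hA))), Finset.insert_erase hxA⟩

/-- Sum over a partition together with an ordered pair of distinct blocks `A`, `B`, grouped by
`W = A ∪ B`. -/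
theorem sum_partitionsOf_sum_block_pair (S : Finset ℕ) (g : Finset ℕ → Finset ℕ → ℕ)
    (hg1 : ∀ B, g ∅ B = 0) (hg2 : ∀ A, g A ∅ = 0) :
    ∑ P ∈ partitionsOf S, ∑ A ∈ P, ∑ B ∈ P.erase A, g A B
      = ∑ W ∈ S.powerset, (∑ A ∈ W.powerset, g A (W \ A)) * Nat.bell (S.card - W.card) := by
  rw [sum_partitionsOf_sum_block S fun A P => ∑ B ∈ P, g A B]
  simp only [fun A => sum_partitionsOf_sum_block (S \ A) fun B _ => g A B]
  simp only [Finset.sum_const, card_partitionsOf, smul_eq_mul]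
  rw [Finset.sum_erase _ (by simp [hg1])]
  simp only [fun A => Finset.sum_erase (f := fun B => Nat.bell ((S \ A) \ B).card * g A B)
    (S \ A).powerset (a := ∅) (by simp [hg2])]
  simp only [Finset.sum_mul]
  rw [Finset.sum_sigma', Finset.sum_sigma']
  refine Finset.sum_bij' (fun x _ => ⟨x.1 ∪ x.2, x.1⟩) (fun x _ => ⟨x.2, x.1 \ x.2⟩)
    ?_ ?_ ?_ ?_ ?_
  · rintro ⟨A, B⟩ h
    simp only [Finset.mem_sigma, Finset.mem_powerset, Finset.subset_sdiff] at h ⊢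
    exact ⟨Finset.union_subset h.1 h.2.1, Finset.subset_union_left⟩
  · rintro ⟨W, A⟩ h
    simp only [Finset.mem_sigma, Finset.mem_powerset] at h ⊢
    exact ⟨h.2.trans h.1, Finset.sdiff_subset_sdiff h.1 subset_rfl⟩
  · rintro ⟨A, B⟩ h
    simp only [Finset.mem_sigma, Finset.mem_powerset, Finset.subset_sdiff] at h
    simp [Finset.union_sdiff_cancel_left h.2.2.symm]
  · rintro ⟨W, A⟩ h
    simp only [Finset.mem_sigma, Finset.mem_powerset] at h
    simp [Finset.union_sdiff_of_subset h.2]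
  · rintro ⟨A, B⟩ h
    simp only [Finset.mem_sigma, Finset.mem_powerset, Finset.subset_sdiff] at h
    simp only [Finset.union_sdiff_cancel_left h.2.2.symm]
    rw [mul_comm, sdiff_sdiff, Finset.sup_eq_union,
      Finset.card_sdiff_of_subset (Finset.union_subset h.1 h.2.1)]

theorem min_lt_min_iff_exists {A B : Finset ℕ} :
    A.min < B.min ↔ ∃ a ∈ A, ∀ b ∈ B, a < b := by
  constructor
  · intro h
    have hne : A.Nonempty := by
      rw [Finset.nonempty_iff_ne_empty]
      rintro rfl
      exact not_top_lt (Finset.min_empty (α := ℕ) ▸ h)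
    refine ⟨A.min' hne, A.min'_mem hne, fun b hb => ?_⟩
    rw [← Finset.coe_min' hne] at h
    exact WithTop.coe_lt_coe.1 (h.trans_le (Finset.min_le hb))
  · rintro ⟨a, ha, h⟩
    refine (Finset.min_le ha).trans_lt ((Finset.lt_inf_iff (WithTop.coe_lt_top a)).2 ?_)
    exact fun b hb => WithTop.coe_lt_coe.2 (h b hb)

theorem blockOf_eq {P : Finset (Finset ℕ)} {S A : Finset ℕ} {x : ℕ} (h : IsPartition P S)
    (hA : A ∈ P) (hx : x ∈ A) : blockOf P x = A := by
  have : P.filter (fun B => x ∈ B) = {A} := by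
    ext B
    simp only [Finset.mem_filter, Finset.mem_singleton]
    exact ⟨fun hB => h.eq_of_mem hB.1 hA hB.2 hx, by rintro rfl; exact ⟨hA, hx⟩⟩
  rw [blockOf, this, Finset.singleton_biUnion, id]

theorem rgf_lt_rgf_of_min_lt {P : Finset (Finset ℕ)} {S A B : Finset ℕ} {x y : ℕ}
    (h : IsPartition P S) (hA : A ∈ P) (hB : B ∈ P) (hx : x ∈ A) (hy : y ∈ B)
    (hlt : A.min < B.min) : rgf P x < rgf P y := by
  rw [rgf, rgf, blockOf_eq h hA hx, blockOf_eq h hB hy]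
  refine Finset.card_lt_card (Finset.ssubset_iff_of_subset (fun C hC => ?_) |>.2
    ⟨B, Finset.mem_filter.2 ⟨hB, le_rfl⟩, fun hn => (Finset.mem_filter.1 hn).2.not_gt hlt⟩)
  rw [Finset.mem_filter] at hC ⊢
  exact ⟨hC.1, hC.2.trans hlt.le⟩

theorem IsPartition.eq_of_min_eq {P : Finset (Finset ℕ)} {S A B : Finset ℕ}
    (h : IsPartition P S) (hA : A ∈ P) (hB : B ∈ P) (hmin : A.min = B.min) : A = B := by
  have hm := Finset.coe_min' (h.nonempty hA)
  exact h.eq_of_mem hA hB (Finset.min'_mem A (h.nonempty hA))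
    (Finset.mem_of_min (hmin ▸ hm.symm))

theorem rgf_lt_rgf_iff {P : Finset (Finset ℕ)} {S A B : Finset ℕ} {x y : ℕ}
    (h : IsPartition P S) (hA : A ∈ P) (hB : B ∈ P) (hx : x ∈ A) (hy : y ∈ B) :
    rgf P x < rgf P y ↔ A.min < B.min := by
  refine ⟨fun hlt => ?_, rgf_lt_rgf_of_min_lt h hA hB hx hy⟩
  rcases lt_trichotomy A.min B.min with hm | hm | hm
  · exact hm
  · rw [rgf, rgf, blockOf_eq h hA hx, blockOf_eq h hB hy, hm] at hlt
    exact absurd hlt (lt_irrefl _)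
  · exact absurd hlt (rgf_lt_rgf_of_min_lt h hB hA hy hx hm).asymm

theorem rgf_eq_rgf_iff {P : Finset (Finset ℕ)} {S A B : Finset ℕ} {x y : ℕ}
    (h : IsPartition P S) (hA : A ∈ P) (hB : B ∈ P) (hx : x ∈ A) (hy : y ∈ B) :
    rgf P x = rgf P y ↔ A = B := by
  constructor
  · intro he
    refine h.eq_of_min_eq hA hB (le_antisymm ?_ ?_) <;> refine not_lt.1 fun hlt => ?_
    · exact (rgf_lt_rgf_of_min_lt h hB hA hy hx hlt).ne' he
    · exact (rgf_lt_rgf_of_min_lt h hA hB hx hy hlt).ne he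
  · rintro rfl
    rw [rgf, rgf, blockOf_eq h hA hx, blockOf_eq h hA hy]

/-- The strictly increasing `r`-tuples of elements of `W`. -/
noncomputable def increasingTuples (r : ℕ) (W : Finset ℕ) : Finset (Fin r → ℕ) :=
  (Fintype.piFinset fun _ => W).filter StrictMono

theorem mem_increasingTuples {r : ℕ} {W : Finset ℕ} {i : Fin r → ℕ} :
    i ∈ increasingTuples r W ↔ StrictMono i ∧ ∀ t, i t ∈ W := by
  simp [increasingTuples, and_comm]

theorem card_increasingTuples (r : ℕ) (W : Finset ℕ) :
    (increasingTuples r W).card = W.card.choose r := by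
  rw [← Finset.card_powersetCard]
  refine Finset.card_bij (fun i _ => Finset.univ.image i) ?_ ?_ ?_
  · intro i hi
    obtain ⟨hm, hW⟩ := mem_increasingTuples.1 hi
    rw [Finset.mem_powersetCard, Finset.card_image_of_injective _ hm.injective]
    exact ⟨Finset.image_subset_iff.2 fun t _ => hW t, by simp⟩
  · intro i hi j hj hij
    have hi := (mem_increasingTuples.1 hi).1
    have hj := (mem_increasingTuples.1 hj).1
    refine (hi.range_inj hj).1 ?_
    simpa using congrArg (fun T : Finset ℕ => (T : Set ℕ)) hij
  · intro T hT
    obtain ⟨hTW, hcard⟩ := Finset.mem_powersetCard.1 hT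
    refine ⟨T.orderEmbOfFin hcard, mem_increasingTuples.2 ⟨(T.orderEmbOfFin hcard).strictMono,
      fun t => hTW (Finset.orderEmbOfFin_mem T hcard t)⟩, ?_⟩
    apply Finset.coe_injective
    simp

/-- The occurrences of `σ` in `[n]` whose letters `1` lie in `A` and whose letters `2` lie in `B`,
where `A` precedes `B` in the order of minima. -/
noncomputable def pairOcc (n : ℕ) {r : ℕ} (σ : Fin r → ℕ) (A B : Finset ℕ) :
    Finset (Fin r → ℕ) :=
  (increasingTuples r (seg n)).filter fun i =>
    A.min < B.min ∧ ∀ t, (σ t = 1 → i t ∈ A) ∧ (σ t = 2 → i t ∈ B)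

theorem mem_pairOcc {n r : ℕ} {σ : Fin r → ℕ} {A B : Finset ℕ} {i : Fin r → ℕ} :
    i ∈ pairOcc n σ A B ↔ i ∈ increasingTuples r (seg n) ∧ A.min < B.min ∧
      ∀ t, (σ t = 1 → i t ∈ A) ∧ (σ t = 2 → i t ∈ B) :=
  Finset.mem_filter

theorem exists_rgf_iff_exists_block {n r : ℕ} {σ : Fin r → ℕ} (hσ : TwoPattern σ)
    {P : Finset (Finset ℕ)} (hP : IsPartition P (seg n)) {i : Fin r → ℕ}
    (hi : ∀ t, i t ∈ seg n) :
    (∃ a b : ℕ, a < b ∧ ∀ t, (σ t = 1 → rgf P (i t) = a) ∧ (σ t = 2 → rgf P (i t) = b))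
      ↔ ∃ A ∈ P, ∃ B ∈ P, A.min < B.min ∧ ∀ t, (σ t = 1 → i t ∈ A) ∧ (σ t = 2 → i t ∈ B) := by
  obtain ⟨-, ⟨t₁, h₁⟩, ⟨t₂, h₂⟩⟩ := hσ
  constructor
  · rintro ⟨a, b, hab, h⟩
    obtain ⟨A, hA, hiA⟩ := hP.exists_mem (hi t₁)
    obtain ⟨B, hB, hiB⟩ := hP.exists_mem (hi t₂)
    refine ⟨A, hA, B, hB, (rgf_lt_rgf_iff hP hA hB hiA hiB).1 ?_, fun t => ⟨fun ht => ?_,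
      fun ht => ?_⟩⟩
    · rwa [(h t₁).1 h₁, (h t₂).2 h₂]
    · obtain ⟨C, hC, hiC⟩ := hP.exists_mem (hi t)
      rwa [← (rgf_eq_rgf_iff hP hC hA hiC hiA).1 (((h t).1 ht).trans ((h t₁).1 h₁).symm)]
    · obtain ⟨C, hC, hiC⟩ := hP.exists_mem (hi t)
      rwa [← (rgf_eq_rgf_iff hP hC hB hiC hiB).1 (((h t).2 ht).trans ((h t₂).2 h₂).symm)]
  · rintro ⟨A, hA, B, hB, hlt, h⟩
    have hA₁ := (h t₁).1 h₁
    have hB₂ := (h t₂).2 h₂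
    exact ⟨rgf P (i t₁), rgf P (i t₂), (rgf_lt_rgf_iff hP hA hB hA₁ hB₂).2 hlt, fun t =>
      ⟨fun ht => (rgf_eq_rgf_iff hP hA hA ((h t).1 ht) hA₁).2 rfl,
        fun ht => (rgf_eq_rgf_iff hP hB hB ((h t).2 ht) hB₂).2 rfl⟩⟩

theorem occ_eq_sum_card_pairOcc {n r : ℕ} {σ : Fin r → ℕ} (hσ : TwoPattern σ)
    {P : Finset (Finset ℕ)} (hP : IsPartition P (seg n)) :
    occ n σ P = ∑ A ∈ P, ∑ B ∈ P.erase A, (pairOcc n σ A B).card := by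
  rw [Finset.sum_sigma', ← Finset.card_biUnion]
  · refine Nat.subtype_card _ fun i => ?_
    simp only [Finset.mem_biUnion, Finset.mem_sigma, Finset.mem_erase, mem_pairOcc,
      mem_increasingTuples]
    constructor
    · rintro ⟨⟨A, B⟩, ⟨hA, -, hB⟩, ⟨hm, hi⟩, h⟩
      exact ⟨hm, hi, (exists_rgf_iff_exists_block hσ hP hi).2 ⟨A, hA, B, hB, h⟩⟩
    · rintro ⟨hm, hi, h⟩
      obtain ⟨A, hA, B, hB, h⟩ := (exists_rgf_iff_exists_block hσ hP hi).1 h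
      exact ⟨⟨A, B⟩, ⟨hA, fun e => h.1.ne (congrArg Finset.min e.symm), hB⟩, ⟨hm, hi⟩, h⟩
  · rintro ⟨A, B⟩ hAB ⟨A', B'⟩ hAB' hne
    refine Finset.disjoint_left.2 fun i hi hi' => hne ?_
    simp only [Finset.coe_sigma, Set.mem_sigma_iff, Finset.mem_coe, Finset.mem_erase] at hAB hAB'
    obtain ⟨-, ⟨t₁, h₁⟩, ⟨t₂, h₂⟩⟩ := hσ
    have hi := (mem_pairOcc.1 hi).2.2
    have hi' := (mem_pairOcc.1 hi').2.2
    rw [hP.eq_of_mem hAB.1 hAB'.1 ((hi t₁).1 h₁) ((hi' t₁).1 h₁),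
      hP.eq_of_mem hAB.2.2 hAB'.2.2 ((hi t₂).2 h₂) ((hi' t₂).2 h₂)]

theorem mem_powerset_and_mem_pairOcc_iff {n r : ℕ} {σ : Fin r → ℕ} (hr : 0 < r)
    (hσ : ∀ t, σ t = 1 ∨ σ t = 2) (hσ1 : σ ⟨0, hr⟩ = 2) {W : Finset ℕ} (hW : W ⊆ seg n)
    (hne : W.Nonempty) (A : Finset ℕ) (i : Fin r → ℕ) :
    A ∈ W.powerset ∧ i ∈ pairOcc n σ A (W \ A) ↔
      A ∈ Finset.Icc (insert (W.min' hne) ((Finset.univ.filter fun t => σ t = 1).image i))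
        (W \ (Finset.univ.filter fun t => σ t = 2).image i) ∧
      i ∈ increasingTuples r (W.erase (W.min' hne)) := by
  simp only [Finset.mem_powerset, mem_pairOcc, mem_increasingTuples, Finset.mem_Icc,
    min_lt_min_iff_exists, Finset.insert_subset_iff, Finset.subset_sdiff,
    Finset.image_subset_iff, Finset.mem_filter, Finset.mem_univ, true_and, Finset.mem_sdiff,
    Finset.mem_erase, Finset.disjoint_right, Finset.forall_mem_image]
  constructor
  · rintro ⟨hAW, ⟨hm, hi⟩, ⟨a, ha, hlt⟩, h⟩
    have hmin : W.min' hne ∈ A := by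
      by_contra hn
      exact absurd (hlt _ ⟨W.min'_mem hne, hn⟩) (not_lt.2 (W.min'_le a (hAW ha)))
    have hiW : ∀ t, i t ∈ W := fun t => by
      rcases hσ t with ht | ht
      · exact hAW ((h t).1 ht)
      · exact ((h t).2 ht).1
    refine ⟨⟨⟨hmin, fun t ht => (h t).1 ht⟩, hAW, fun t ht => ((h t).2 ht).2⟩, hm,
      fun t => ⟨fun e => ?_, hiW t⟩⟩
    have h0 := (h ⟨0, hr⟩).2 hσ1
    have hle : i ⟨0, hr⟩ ≤ i t := hm.monotone (Nat.zero_le _)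
    exact h0.2 (le_antisymm (hle.trans_eq e) (W.min'_le _ h0.1) ▸ hmin)
  · rintro ⟨⟨⟨hmin, h1⟩, hAW, h2⟩, hm, hi⟩
    refine ⟨hAW, ⟨hm, fun t => hW (hi t).2⟩, ⟨_, hmin, fun b hb => ?_⟩, fun t =>
      ⟨fun ht => h1 t ht, fun ht => ⟨(hi t).2, h2 ht⟩⟩⟩
    exact lt_of_le_of_ne (W.min'_le b hb.1) fun e => hb.2 (e ▸ hmin)

theorem card_Icc_colorings {r : ℕ} {σ : Fin r → ℕ} (hσ : ∀ t, σ t = 1 ∨ σ t = 2)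
    {W : Finset ℕ} {m : ℕ} (hm : m ∈ W) {i : Fin r → ℕ}
    (hi : i ∈ increasingTuples r (W.erase m)) :
    (Finset.Icc (insert m ((Finset.univ.filter fun t => σ t = 1).image i))
        (W \ (Finset.univ.filter fun t => σ t = 2).image i)).card = 2 ^ (W.card - 1 - r) := by
  obtain ⟨hmono, hi⟩ := mem_increasingTuples.1 hi
  simp only [Finset.mem_erase] at hi
  have hr : (Finset.univ.filter fun t => σ t = 1).card
      + (Finset.univ.filter fun t => σ t = 2).card = r := by
    rw [← Finset.card_union_of_disjoint, ← Finset.filter_or, Finset.filter_true_of_mem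
      fun t _ => hσ t, Finset.card_univ, Fintype.card_fin]
    exact Finset.disjoint_filter.2 fun t _ h => by omega
  rw [Finset.card_Icc_finset, Finset.card_sdiff_of_subset, Finset.card_insert_of_notMem,
    Finset.card_image_of_injective _ hmono.injective,
    Finset.card_image_of_injective _ hmono.injective]
  · congr 1
    omega
  · simp only [Finset.mem_image, not_exists, not_and]
    exact fun t _ => (hi t).1
  · exact Finset.image_subset_iff.2 fun t _ => (hi t).2
  · simp only [Finset.insert_subset_iff, Finset.subset_sdiff, Finset.image_subset_iff,
      Finset.disjoint_right, Finset.mem_filter, Finset.mem_univ,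
      true_and, Finset.mem_insert, Finset.mem_image, not_or, not_exists, not_and]
    refine ⟨⟨hm, fun t _ => (hi t).2⟩, ?_⟩
    rintro _ ⟨t, ht, rfl⟩
    refine ⟨(hi t).1, fun s hs e => ?_⟩
    obtain rfl := hmono.injective e
    omega

theorem sum_card_pairOcc {n r : ℕ} {σ : Fin r → ℕ} (hr : 0 < r)
    (hσ : ∀ t, σ t = 1 ∨ σ t = 2) (hσ1 : σ ⟨0, hr⟩ = 2) {W : Finset ℕ} (hW : W ⊆ seg n) :
    ∑ A ∈ W.powerset, (pairOcc n σ A (W \ A)).card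
      = (W.card - 1).choose r * 2 ^ (W.card - 1 - r) := by
  rcases W.eq_empty_or_nonempty with rfl | hne
  · simp [pairOcc, Nat.choose_eq_zero_of_lt hr]
  · simp only [Finset.card_eq_sum_ones (pairOcc _ _ _ _)]
    rw [Finset.sum_comm' (mem_powerset_and_mem_pairOcc_iff hr hσ hσ1 hW hne),
      Finset.sum_congr rfl fun i hi => (Finset.card_eq_sum_ones _).symm.trans
        (card_Icc_colorings hσ (W.min'_mem hne) hi),
      Finset.sum_const, card_increasingTuples, Finset.card_erase_of_mem (W.min'_mem hne),
      smul_eq_mul]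

theorem sum_occ_eq_occSum {n r : ℕ} {σ : Fin r → ℕ} (hr : 0 < r) (hσ : TwoPattern σ)
    (hσ1 : σ ⟨0, hr⟩ = 2) : ∑ P ∈ partitions n, occ n σ P = occSum n r := by
  rw [show partitions n = partitionsOf (seg n) from rfl, Finset.sum_congr rfl fun P hP =>
    occ_eq_sum_card_pairOcc hσ (mem_partitionsOf.1 hP), sum_partitionsOf_sum_block_pair,
    Finset.sum_congr rfl fun W hW => congrArg (· * _)
      (sum_card_pairOcc hr hσ.1 hσ1 (Finset.mem_powerset.1 hW))]
  · have h := Finset.sum_powerset_apply_card (fun s => (s - 1).choose r * 2 ^ (s - 1 - r) *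
      Nat.bell ((seg n).card - s)) (x := seg n)
    rw [h, Finset.sum_range_succ']
    simp [seg, occSum, Nat.choose_eq_zero_of_lt hr, mul_assoc]
  · intro B
    simp [pairOcc]
  · intro A
    rw [Finset.card_eq_zero, Finset.eq_empty_iff_forall_notMem]
    exact fun i hi => Finset.notMem_empty _ (((mem_pairOcc.1 hi).2.2 ⟨0, hr⟩).2 hσ1)

theorem bell_eq_nat_bell (n : ℕ) : bell n = Nat.bell n := by
  rw [bell, show partitions n = partitionsOf (seg n) from rfl, card_partitionsOf, seg,
    Nat.card_Icc, Nat.add_sub_cancel]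

/-- exact total number of occurrences over `Π_n` of a 2-pattern with first letter 2. -/
theorem occ2_mean_over_partitions {r : ℕ} (hr : 0 < r) (σ : Fin r → ℕ)
    (hσ : TwoPattern σ) (hσ1 : σ ⟨0, hr⟩ = 2) (n : ℕ) (hn : r ≤ n) :
    (∑ π ∈ partitions n, (occ n σ π : ℚ))
      = (∑ j ∈ Finset.range (r+1),
          ((-1 : ℚ)^(r-j) / 2^(r-j+1)) *
              ((n.choose j : ℚ) + (1/2) * (if j = 0 then 0 else (n.choose (j-1) : ℚ)))
            * (bell (n+2-j) : ℚ))
        - (1/2) * (n.choose r : ℚ) * (bell (n+1-r) : ℚ)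
        + ((-1 : ℚ)^(r+1) / 2^(r+1)) * (bell n : ℚ) := by
  simp only [bell_eq_nat_bell]
  rw [← occSum_eq n r hn, ← sum_occ_eq_occSum hr hσ hσ1, Nat.cast_sum]
end

section
/- For every integer r ∈ ℤ there exists a function ε : ℕ → ℝ with ε(n) → 0 as n → ∞ such that for all sufficiently large n (in particular n + r ≥ 0), B_{n+r}/B_n = (n/log n)^r · (1 + r·(log log n/log n)·(1 + ε(n))). -/
open scoped Classical

open Filter Topology

/-- `u = 1 + c q + o(q)` along the natural numbers. -/
def HasFirstOrder (q u : ℕ → ℝ) (c : ℝ) : Prop :=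
  Tendsto (fun n => (u n - 1) / q n) atTop (𝓝 c)

namespace HasFirstOrder

variable {q u v : ℕ → ℝ} {c d : ℝ}

theorem congr' (hu : HasFirstOrder q u c) (h : ∀ᶠ n in atTop, u n = v n) :
    HasFirstOrder q v c :=
  Tendsto.congr' (h.mono fun n hn => by simp only [hn]) hu

theorem one : HasFirstOrder q (fun _ => 1) 0 := by
  simp [HasFirstOrder]

theorem tendsto_one (hq : Tendsto q atTop (𝓝 0)) (hq0 : ∀ᶠ n in atTop, q n ≠ 0)
    (hu : HasFirstOrder q u c) : Tendsto u atTop (𝓝 1) := by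
  have h := (hu.mul hq).add_const 1
  simp only [mul_zero, zero_add] at h
  refine h.congr' (hq0.mono fun n hn => ?_)
  field_simp
  ring

theorem mul (hq : Tendsto q atTop (𝓝 0)) (hq0 : ∀ᶠ n in atTop, q n ≠ 0)
    (hu : HasFirstOrder q u c) (hv : HasFirstOrder q v d) :
    HasFirstOrder q (fun n => u n * v n) (c + d) := by
  have h := (Tendsto.mul hu (tendsto_one hq hq0 hv)).add hv
  rw [mul_one] at h
  refine Tendsto.congr' (hq0.mono fun n hn => ?_) h
  field_simp
  ring

theorem inv (hq : Tendsto q atTop (𝓝 0)) (hq0 : ∀ᶠ n in atTop, q n ≠ 0)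
    (hu : HasFirstOrder q u c) : HasFirstOrder q (fun n => (u n)⁻¹) (-c) := by
  have h1 := tendsto_one hq hq0 hu
  have h := (Tendsto.div hu h1 one_ne_zero).neg
  rw [div_one] at h
  refine Tendsto.congr' ?_ h
  filter_upwards [hq0, h1.eventually_ne one_ne_zero] with n hn hun
  rw [Pi.div_apply]
  field_simp
  ring

theorem zpow (hq : Tendsto q atTop (𝓝 0)) (hq0 : ∀ᶠ n in atTop, q n ≠ 0)
    (hu : HasFirstOrder q u 0) (r : ℤ) : HasFirstOrder q (fun n => u n ^ r) 0 := by
  have hpow (k : ℕ) : HasFirstOrder q (fun n => u n ^ k) 0 := by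
    induction k with
    | zero => simpa using one
    | succ k ih => simpa [pow_succ] using mul hq hq0 ih hu
  obtain ⟨k, rfl | rfl⟩ := r.eq_nat_or_neg
  · simpa using hpow k
  · simpa using inv hq hq0 (hpow k)

theorem comp_succ_iff (hq0 : ∀ᶠ n in atTop, q n ≠ 0)
    (hq1 : Tendsto (fun n => q (n + 1) / q n) atTop (𝓝 1)) :
    HasFirstOrder q (fun n => u (n + 1)) c ↔ HasFirstOrder q u c := by
  have hs : ∀ᶠ n in atTop, q (n + 1) ≠ 0 := (tendsto_add_atTop_nat 1).eventually hq0
  unfold HasFirstOrder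
  rw [← tendsto_add_atTop_iff_nat (f := fun n => (u n - 1) / q n) 1]
  constructor <;> intro h
  · have h' := Tendsto.div h hq1 one_ne_zero
    rw [div_one] at h'
    refine Tendsto.congr' ?_ h'
    filter_upwards [hq0, hs] with n hn hn'
    simp only [Pi.div_apply]
    field_simp
  · have h' := Tendsto.mul h hq1
    rw [mul_one] at h'
    refine Tendsto.congr' ?_ h'
    filter_upwards [hq0, hs] with n hn hn'
    field_simp

end HasFirstOrder

theorem tendsto_div_one_of_sub_tendsto_zero {a b : ℕ → ℝ} (ha : Tendsto a atTop atTop)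
    (hab : Tendsto (fun n => b n - a n) atTop (𝓝 0)) :
    Tendsto (fun n => b n / a n) atTop (𝓝 1) := by
  have h := (hab.div_atTop ha).add_const 1
  rw [zero_add] at h
  refine h.congr' ?_
  filter_upwards [ha.eventually_ne_atTop 0] with n hn
  field_simp
  ring

theorem tendsto_log_natCast : Tendsto (fun n : ℕ => Real.log n) atTop atTop :=
  Real.tendsto_log_atTop.comp tendsto_natCast_atTop_atTop

theorem tendsto_log_log_natCast :
    Tendsto (fun n : ℕ => Real.log (Real.log n)) atTop atTop :=
  Real.tendsto_log_atTop.comp tendsto_log_natCast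

theorem tendsto_log_succ_sub_log :
    Tendsto (fun n : ℕ => Real.log (n + 1 : ℕ) - Real.log n) atTop (𝓝 0) := by
  simpa using Real.tendsto_log_nat_add_one_sub_log

theorem tendsto_log_succ_div_log :
    Tendsto (fun n : ℕ => Real.log (n + 1 : ℕ) / Real.log n) atTop (𝓝 1) :=
  tendsto_div_one_of_sub_tendsto_zero tendsto_log_natCast tendsto_log_succ_sub_log

theorem tendsto_log_log_succ_div_log_log :
    Tendsto (fun n : ℕ => Real.log (Real.log (n + 1 : ℕ)) / Real.log (Real.log n))
      atTop (𝓝 1) := by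
  refine tendsto_div_one_of_sub_tendsto_zero tendsto_log_log_natCast ?_
  have h := tendsto_log_succ_div_log.log one_ne_zero
  rw [Real.log_one] at h
  refine h.congr' ?_
  have hl := tendsto_log_natCast.eventually_ne_atTop 0
  filter_upwards [hl, (tendsto_add_atTop_nat 1).eventually hl] with n hn hn'
  exact Real.log_div hn' hn

/-- The gauge `log log n / log n`. -/
noncomputable def logLogRatio (n : ℕ) : ℝ := Real.log (Real.log n) / Real.log n

theorem tendsto_logLogRatio : Tendsto logLogRatio atTop (𝓝 0) :=
  (Real.isLittleO_log_id_atTop.tendsto_div_nhds_zero).comp tendsto_log_natCast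

theorem logLogRatio_eventually_ne_zero : ∀ᶠ n in atTop, logLogRatio n ≠ 0 := by
  filter_upwards [tendsto_log_natCast.eventually_ne_atTop 0,
    tendsto_log_log_natCast.eventually_ne_atTop 0] with n hn hn'
  exact div_ne_zero hn' hn

theorem tendsto_logLogRatio_succ_div :
    Tendsto (fun n => logLogRatio (n + 1) / logLogRatio n) atTop (𝓝 1) := by
  have h := tendsto_log_log_succ_div_log_log.div tendsto_log_succ_div_log one_ne_zero
  rw [div_one] at h
  refine h.congr fun n => ?_
  exact div_div_div_comm ..

theorem hasFirstOrder_succ_div :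
    HasFirstOrder logLogRatio (fun n => ((n + 1 : ℕ) : ℝ) / n) 0 := by
  have h := ((Real.isLittleO_log_id_atTop.tendsto_div_nhds_zero).comp
    tendsto_natCast_atTop_atTop).div_atTop tendsto_log_log_natCast
  refine h.congr' ?_
  filter_upwards [eventually_ne_atTop 0, tendsto_log_natCast.eventually_ne_atTop 0,
    tendsto_log_log_natCast.eventually_ne_atTop 0] with n hn hl hll
  have hn' : (n : ℝ) ≠ 0 := Nat.cast_ne_zero.mpr hn
  simp only [Function.comp_apply, id, logLogRatio]
  push_cast
  field_simp
  ring

theorem hasFirstOrder_log_succ_div_log :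
    HasFirstOrder logLogRatio (fun n => Real.log (n + 1 : ℕ) / Real.log n) 0 := by
  refine (tendsto_log_succ_sub_log.div_atTop tendsto_log_log_natCast).congr' ?_
  filter_upwards [tendsto_log_natCast.eventually_ne_atTop 0,
    tendsto_log_log_natCast.eventually_ne_atTop 0] with n hl hll
  simp only [logLogRatio]
  field_simp

theorem hasFirstOrder_div_log_succ :
    HasFirstOrder logLogRatio
      (fun n => ((n + 1 : ℕ) / Real.log (n + 1 : ℕ)) / (n / Real.log n)) 0 := by
  have h := hasFirstOrder_succ_div.mul tendsto_logLogRatio logLogRatio_eventually_ne_zero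
    (hasFirstOrder_log_succ_div_log.inv tendsto_logLogRatio logLogRatio_eventually_ne_zero)
  rw [neg_zero, add_zero] at h
  refine h.congr' (Eventually.of_forall fun n => ?_)
  rw [← div_eq_mul_inv]
  exact div_div_div_comm ..

/-- A sequence `b` with `b (n + 1) / b n = f n * (1 + q n + o(q n))`, where `f` varies slowly,
satisfies `b (n + r) / b n = f n ^ r * (1 + r * q n + o(q n))`. -/
theorem hasFirstOrder_shift_quotient {q b f : ℕ → ℝ} (hq : Tendsto q atTop (𝓝 0))
    (hq0 : ∀ᶠ n in atTop, q n ≠ 0) (hq1 : Tendsto (fun n => q (n + 1) / q n) atTop (𝓝 1))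
    (hb : ∀ᶠ n in atTop, b n ≠ 0) (hf : ∀ᶠ n in atTop, f n ≠ 0)
    (hf1 : HasFirstOrder q (fun n => f (n + 1) / f n) 0)
    (hbf : HasFirstOrder q (fun n => b (n + 1) / b n / f n) 1) (r : ℤ) :
    HasFirstOrder q (fun n => b ((n : ℤ) + r).toNat / b n / f n ^ r) r := by
  have hb' := (tendsto_add_atTop_nat 1).eventually hb
  have hf' := (tendsto_add_atTop_nat 1).eventually hf
  have hstep (r : ℤ) : ∀ᶠ n : ℕ in atTop,
      b (((n + 1 : ℕ) : ℤ) + r).toNat / b (n + 1) / f (n + 1) ^ r *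
          ((f (n + 1) / f n) ^ r * (b (n + 1) / b n / f n)) =
        b ((n : ℤ) + (r + 1)).toNat / b n / f n ^ (r + 1) := by
    filter_upwards [hb, hf, hb', hf'] with n h1 h2 h3 h4
    have e : ((n + 1 : ℕ) : ℤ) + r = (n : ℤ) + (r + 1) := by push_cast; ring
    rw [e, div_zpow, zpow_add_one₀ h2]
    have := zpow_ne_zero r h2
    have := zpow_ne_zero r h4
    field_simp
  have hfac (r : ℤ) : HasFirstOrder q
      (fun n => (f (n + 1) / f n) ^ r * (b (n + 1) / b n / f n)) 1 := by
    simpa using (hf1.zpow hq hq0 r).mul hq hq0 hbf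
  induction r using Int.induction_on with
  | zero =>
    rw [Int.cast_zero]
    exact HasFirstOrder.one.congr' (hb.mono fun n hn => by simp [hn])
  | succ k ih =>
    rw [← HasFirstOrder.comp_succ_iff hq0 hq1] at ih
    have h := (ih.mul hq hq0 (hfac k)).congr' (hstep k)
    simpa using h
  | pred k ih =>
    rw [← HasFirstOrder.comp_succ_iff hq0 hq1]
    have hs := hstep (-(k : ℤ) - 1)
    rw [sub_add_cancel] at hs
    have h := ih.mul hq hq0 ((hfac (-(k : ℤ) - 1)).inv hq hq0)
    have hc : ((-(k : ℤ) : ℤ) : ℝ) + -1 = ((-(k : ℤ) - 1 : ℤ) : ℝ) := by push_cast; ring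
    rw [hc] at h
    refine h.congr' ?_
    filter_upwards [hs, hb, hf, hb', hf'] with n h0 h1 h2 h3 h4
    rw [← h0, mul_inv_cancel_right₀]
    exact mul_ne_zero (zpow_ne_zero _ (div_ne_zero h4 h2))
      (div_ne_zero (div_ne_zero h3 h1) h2)

/-- asymptotics of quotients of Bell numbers, assuming the
Salvy–Shackell estimate for `B_{n+1}/B_n`. -/
theorem bell_quotient_asymptotics
    (hSS : ∃ δ : ℕ → ℝ, Filter.Tendsto δ Filter.atTop (nhds 0) ∧
      ∀ᶠ n : ℕ in Filter.atTop,
        (bell (n+1) : ℝ) / (bell n : ℝ)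
          = ((n : ℝ) / Real.log n) *
              (1 + (Real.log (Real.log n) / Real.log n) * (1 + δ n)))
    (r : ℤ) :
    ∃ ε : ℕ → ℝ, Filter.Tendsto ε Filter.atTop (nhds 0) ∧
      ∀ᶠ n : ℕ in Filter.atTop,
        0 ≤ (n : ℤ) + r ∧
        (bell ((n : ℤ) + r).toNat : ℝ) / (bell n : ℝ)
          = ((n : ℝ) / Real.log n) ^ r *
              (1 + (r : ℝ) * (Real.log (Real.log n) / Real.log n) * (1 + ε n)) := by
  obtain ⟨δ, hδ, hSS⟩ := hSS
  have hq := tendsto_logLogRatio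
  have hq0 := logLogRatio_eventually_ne_zero
  have hf : ∀ᶠ n : ℕ in atTop, (n : ℝ) / Real.log n ≠ 0 := by
    filter_upwards [eventually_ne_atTop 0, tendsto_log_natCast.eventually_ne_atTop 0]
      with n hn hl
    exact div_ne_zero (Nat.cast_ne_zero.mpr hn) hl
  have hbf : HasFirstOrder logLogRatio
      (fun n => (bell (n + 1) : ℝ) / bell n / (n / Real.log n)) 1 := by
    have h := hδ.const_add 1
    rw [add_zero] at h
    refine h.congr' ?_
    filter_upwards [hSS, hf, hq0] with n hn hfn hqn
    rw [hn, mul_div_cancel_left₀ _ hfn, add_sub_cancel_left]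
    exact (mul_div_cancel_left₀ _ hqn).symm
  have hb : ∀ᶠ n : ℕ in atTop, (bell n : ℝ) ≠ 0 := by
    filter_upwards [(hbf.tendsto_one hq hq0).eventually_ne one_ne_zero] with n hn h0
    simp [h0] at hn
  have hr := hasFirstOrder_shift_quotient (b := fun n => (bell n : ℝ)) hq hq0
    tendsto_logLogRatio_succ_div hb hf hasFirstOrder_div_log_succ hbf r
  have hnonneg : ∀ᶠ n : ℕ in atTop, 0 ≤ (n : ℤ) + r := by
    filter_upwards [eventually_ge_atTop r.natAbs] with n hn
    omega
  obtain rfl | hr0 := eq_or_ne r 0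
  · refine ⟨fun _ => 0, tendsto_const_nhds, ?_⟩
    filter_upwards [hb] with n hn
    simp [hn]
  have hrR : (r : ℝ) ≠ 0 := Int.cast_ne_zero.mpr hr0
  refine ⟨fun n => ((bell ((n : ℤ) + r).toNat : ℝ) / bell n / (n / Real.log n) ^ r - 1) /
    logLogRatio n / r - 1, ?_, ?_⟩
  · simpa [hrR] using (Tendsto.div_const hr (r : ℝ)).sub_const 1
  · filter_upwards [hnonneg, hf, hq0] with n hn hfn hqn
    refine ⟨hn, ?_⟩
    have hz := zpow_ne_zero r hfn
    change _ = _ * (1 + (r : ℝ) * logLogRatio n * _)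
    generalize (n / Real.log n : ℝ) ^ r = z at *
    field_simp
    ring
end

section
/- Fix integers m ≥ 1 and k ≥ 1, and let Π_{(m^k)} denote the set of partitions of [mk] into exactly k blocks, each of size m. Then the average number of linear crossings over Π_{(m^k)} equals C(k,2)·(m − 2 + 2/C(2m,m)); equivalently, Σ_{π ∈ Π_{(m^k)}} crol(π) = C(k,2)·(m − 2 + 2/C(2m,m))·|Π_{(m^k)}| (an identity in ℚ), where C(k,2) and C(2m,m) are binomial coefficients. -/
open scoped Classical

/-- `Π_{(m^k)}`: partitions of `[m*k]` into exactly `k` blocks, each of size `m`. -/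
noncomputable def partitionsUniform (m k : ℕ) : Finset (Finset (Finset ℕ)) :=
  (partitions (m * k)).filter fun P => P.card = k ∧ ∀ B ∈ P, B.card = m

/-- Pairs consisting of an edge of `A` and an edge of `B` such that the two edges cross, the
edge of `A` opening first. -/
def crossings {α : Type*} [LinearOrder α] (A B : Finset α) : Finset ((α × α) × α × α) :=
  ((A ×ˢ A) ×ˢ (B ×ˢ B)).filter fun e =>
    (∀ p ∈ A, ¬(e.1.1 < p ∧ p < e.1.2)) ∧ (∀ p ∈ B, ¬(e.2.1 < p ∧ p < e.2.2)) ∧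
      e.1.1 < e.2.1 ∧ e.2.1 < e.1.2 ∧ e.1.2 < e.2.2

theorem mem_crossings {α : Type*} [LinearOrder α] {A B : Finset α} {e : (α × α) × α × α} :
    e ∈ crossings A B ↔ ((e.1.1 ∈ A ∧ e.1.2 ∈ A) ∧ e.2.1 ∈ B ∧ e.2.2 ∈ B) ∧
      (∀ p ∈ A, ¬(e.1.1 < p ∧ p < e.1.2)) ∧ (∀ p ∈ B, ¬(e.2.1 < p ∧ p < e.2.2)) ∧
      e.1.1 < e.2.1 ∧ e.2.1 < e.1.2 ∧ e.1.2 < e.2.2 := by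
  simp only [crossings, Finset.mem_filter, Finset.mem_product]

theorem card_crossings_map {α β : Type*} [LinearOrder α] [LinearOrder β] (f : α ↪o β)
    (A B : Finset α) :
    (crossings (A.map f.toEmbedding) (B.map f.toEmbedding)).card = (crossings A B).card := by
  symm
  refine Finset.card_bij (fun e _ => ((f e.1.1, f e.1.2), (f e.2.1, f e.2.2))) ?_ ?_ ?_
  · rintro ⟨⟨a, b⟩, c, d⟩ h
    simpa [mem_crossings] using h
  · rintro ⟨⟨a, b⟩, c, d⟩ - ⟨⟨a', b'⟩, c', d'⟩ - h
    simpa using h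
  · rintro ⟨⟨a, b⟩, c, d⟩ h
    have h' := h
    rw [mem_crossings] at h'
    obtain ⟨⟨⟨ha, hb⟩, hc, hd⟩, -⟩ := h'
    simp only [Finset.mem_map] at ha hb hc hd
    obtain ⟨a, -, rfl⟩ := ha
    obtain ⟨b, -, rfl⟩ := hb
    obtain ⟨c, -, rfl⟩ := hc
    obtain ⟨d, -, rfl⟩ := hd
    exact ⟨((a, b), (c, d)), by simpa [mem_crossings] using h, rfl⟩

theorem sum_crossings_map {α β : Type*} [LinearOrder α] [LinearOrder β] (f : α ↪o β)
    (m : ℕ) (U : Finset α) :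
    ∑ A ∈ (U.map f.toEmbedding).powersetCard m,
        (crossings A ((U.map f.toEmbedding) \ A)).card =
      ∑ A ∈ U.powersetCard m, (crossings A (U \ A)).card := by
  rw [Finset.powersetCard_map, Finset.sum_map]
  refine Finset.sum_congr rfl fun A _ => ?_
  rw [← card_crossings_map f A (U \ A)]
  change (crossings (A.map f.toEmbedding) (U.map f.toEmbedding \ A.map f.toEmbedding)).card = _
  congr 2
  ext x
  simp only [Finset.mem_sdiff, Finset.mem_map]
  constructor
  · rintro ⟨⟨y, hy, rfl⟩, h⟩
    exact ⟨y, ⟨hy, fun hA => h ⟨y, hA, rfl⟩⟩, rfl⟩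
  · rintro ⟨y, ⟨hy, hA⟩, rfl⟩
    refine ⟨⟨y, hy, rfl⟩, ?_⟩
    rintro ⟨z, hz, h⟩
    exact hA (f.injective h ▸ hz)

theorem sum_crossings_eq_range (m : ℕ) (U : Finset ℕ) :
    ∑ A ∈ U.powersetCard m, (crossings A (U \ A)).card =
      ∑ A ∈ (Finset.range U.card).powersetCard m,
        (crossings A (Finset.range U.card \ A)).card := by
  have h1 := sum_crossings_map (U.orderEmbOfFin rfl) m Finset.univ
  have h2 := sum_crossings_map (Fin.valOrderEmb U.card) m Finset.univ
  have e1 : Finset.univ.map (U.orderEmbOfFin rfl).toEmbedding = U := by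
    simp
  have e2 : Finset.univ.map (Fin.valOrderEmb U.card).toEmbedding = Finset.range U.card := by
    ext x
    simp only [Finset.mem_map, Finset.mem_univ, true_and, Finset.mem_range]
    exact ⟨fun ⟨y, hy⟩ => hy ▸ y.2, fun h => ⟨⟨x, h⟩, rfl⟩⟩
  rw [e1] at h1
  rw [e2] at h2
  rw [h1, h2]

/-- The positions `t < n` with `t ∉ A` and `t + 1 ∈ A`. -/
def rises (A : Finset ℕ) (n : ℕ) : Finset ℕ :=
  (Finset.range n).filter fun t => t ∉ A ∧ t + 1 ∈ A

theorem card_crossings_range (n : ℕ) (A : Finset ℕ) :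
    (crossings A (Finset.range n \ A)).card =
      ((rises A n).filter fun t =>
        (∃ a ∈ A, a < t) ∧ ∃ b ∈ Finset.range n \ A, t + 1 < b).card := by
  refine Finset.card_bij (fun e _ => e.2.1) ?_ ?_ ?_
  · rintro ⟨⟨a, b⟩, c, d⟩ h
    simp only [mem_crossings, rises, Finset.mem_filter, Finset.mem_sdiff, Finset.mem_range] at h ⊢
    obtain ⟨⟨⟨ha, hb⟩, ⟨hc, hc'⟩, hd, hd'⟩, h1, h2, h3, h4, h5⟩ := h
    have : b = c + 1 := by
      by_contra hne
      by_cases hm : c + 1 ∈ A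
      · exact h1 _ hm ⟨by omega, by omega⟩
      · exact h2 (c + 1) ⟨by omega, hm⟩ ⟨by omega, by omega⟩
    subst this
    exact ⟨⟨hc, hc', hb⟩, ⟨a, ha, h3⟩, d, ⟨hd, hd'⟩, h5⟩
  · have key : ∀ e ∈ crossings A (Finset.range n \ A), e.1.2 = e.2.1 + 1 := by
      rintro ⟨⟨a, b⟩, c, d⟩ h
      simp only [mem_crossings, Finset.mem_sdiff, Finset.mem_range] at h ⊢
      obtain ⟨⟨⟨ha, hb⟩, ⟨hc, hc'⟩, hd, hd'⟩, h1, h2, h3, h4, h5⟩ := h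
      by_contra hne
      by_cases hm : c + 1 ∈ A
      · exact h1 _ hm ⟨by omega, by omega⟩
      · exact h2 (c + 1) ⟨by omega, hm⟩ ⟨by omega, by omega⟩
    intro e he e' he' hee
    have k1 := key e he
    have k2 := key e' he'
    obtain ⟨⟨a, b⟩, c, d⟩ := e
    obtain ⟨⟨a', b'⟩, c', d'⟩ := e'
    simp only [mem_crossings] at he he' hee k1 k2
    obtain ⟨⟨⟨ha, hb⟩, hc, hd⟩, h1, h2, h3, h4, h5⟩ := he
    obtain ⟨⟨⟨ha', hb'⟩, hc', hd'⟩, h1', h2', h3', h4', h5'⟩ := he'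
    have := h1 _ ha'
    have := h1' _ ha
    have := h2 _ hd'
    have := h2' _ hd
    simp only [Prod.mk.injEq]
    omega
  · intro t ht
    simp only [rises, Finset.mem_filter, Finset.mem_range] at ht
    obtain ⟨⟨htn, htA, htA'⟩, ⟨a, ha, hat⟩, b, hb, hbt⟩ := ht
    obtain ⟨i, hi, himax⟩ := Finset.exists_max_image (A.filter (· < t)) id
      ⟨a, by simp [ha, hat]⟩
    obtain ⟨j, hj, hjmin⟩ := Finset.exists_min_image
      ((Finset.range n \ A).filter (t + 1 < ·)) id ⟨b, Finset.mem_filter.2 ⟨hb, hbt⟩⟩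
    rw [Finset.mem_filter] at hi hj
    refine ⟨((i, t + 1), (t, j)), ?_, rfl⟩
    rw [mem_crossings]
    refine ⟨⟨⟨hi.1, htA'⟩, by simp [htn, htA], hj.1⟩, ?_, ?_, hi.2, by simp, hj.2⟩
    · rintro p hp ⟨hp1, hp2⟩
      have : p ≠ t := fun h => htA (h ▸ hp)
      have := himax p (Finset.mem_filter.2 ⟨hp, by simp at hp2; omega⟩)
      simp at this hp1
      omega
    · rintro p hp ⟨hp1, hp2⟩
      have : p ≠ t + 1 := fun h => (Finset.mem_sdiff.1 hp).2 (h ▸ htA')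
      have := hjmin p (Finset.mem_filter.2 ⟨hp, by simp at hp1; omega⟩)
      simp at this hp2
      omega

theorem card_powersetCard_notMem {α : Type*} [DecidableEq α] {S : Finset α} {x : α} (hx : x ∈ S)
    (m : ℕ) : ((S.powersetCard m).filter (x ∉ ·)).card = (S.card - 1).choose m := by
  rw [← Finset.card_erase_of_mem hx, ← Finset.card_powersetCard]
  congr 1
  ext A
  simp only [Finset.mem_filter, Finset.mem_powersetCard, Finset.subset_erase]
  tauto

theorem card_powersetCard_notMem_mem {α : Type*} [DecidableEq α] {S : Finset α} {x y : α}
    (hx : x ∈ S) (hy : y ∈ S) (hxy : x ≠ y) (m : ℕ) :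
    ((S.powersetCard (m + 1)).filter fun A => x ∉ A ∧ y ∈ A).card = (S.card - 2).choose m := by
  have h := Finset.card_filter_add_card_filter_not (s := (S.erase x).powersetCard (m + 1)) (y ∈ ·)
  have hy' : y ∈ S.erase x := Finset.mem_erase.2 ⟨hxy.symm, hy⟩
  rw [card_powersetCard_notMem hy', Finset.card_powersetCard, Finset.card_erase_of_mem hx] at h
  have h2 : 2 ≤ S.card := by
    have := Finset.card_pos.2 ⟨y, hy'⟩
    rw [Finset.card_erase_of_mem hx] at this
    omega
  obtain ⟨c, hc⟩ := Nat.exists_eq_add_of_le h2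
  have e : ((S.powersetCard (m + 1)).filter fun A => x ∉ A ∧ y ∈ A) =
      ((S.erase x).powersetCard (m + 1)).filter (y ∈ ·) := by
    ext A
    simp only [Finset.mem_filter, Finset.mem_powersetCard, Finset.subset_erase]
    tauto
  rw [e]
  have e1 : S.card - 1 = c + 1 := by omega
  have e2 : S.card - 2 = c := by omega
  rw [e1, Nat.choose_succ_succ', Nat.add_sub_cancel] at h
  rw [e2]
  omega

theorem card_filter_and_add_card_filter_not {α : Type*} (R : Finset α) (p q : α → Prop) :
    (R.filter fun t => p t ∧ q t).card + (R.filter fun t => ¬p t).card +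
      (R.filter fun t => ¬q t).card = R.card + (R.filter fun t => ¬p t ∧ ¬q t).card := by
  rw [Finset.card_eq_sum_ones R]
  simp only [Finset.card_filter, ← Finset.sum_add_distrib]
  refine Finset.sum_congr rfl fun t _ => ?_
  by_cases hp : p t <;> by_cases hq : q t <;> simp [hp, hq]

theorem card_rises_filter_initial {n : ℕ} {A : Finset ℕ} (hA : A ⊆ Finset.range n)
    (hne : A.Nonempty) :
    ((rises A n).filter fun t => ¬∃ a ∈ A, a < t).card = if 0 ∉ A then 1 else 0 := by
  have hlt : ∀ a ∈ A, a < n := fun a ha => Finset.mem_range.1 (hA ha)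
  split_ifs with h
  rotate_left
  · obtain ⟨a, ha, hmin⟩ := Finset.exists_min_image A id hne
    simp only [id] at hmin
    have ha0 : a ≠ 0 := fun h0 => h (h0 ▸ ha)
    rw [Finset.card_eq_one]
    refine ⟨a - 1, ?_⟩
    ext t
    simp only [rises, Finset.mem_filter, Finset.mem_range, Finset.mem_singleton]
    constructor
    · rintro ⟨⟨-, htA, ht⟩, hn⟩
      have h1 := hmin _ ht
      have h2 : ¬a < t := fun h => hn ⟨a, ha, h⟩
      have h3 : a ≠ t := fun h => htA (h ▸ ha)
      omega
    · rintro rfl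
      have := hlt a ha
      refine ⟨⟨by omega, fun h => ?_, by rwa [Nat.sub_add_cancel (by omega)]⟩, ?_⟩
      · have := hmin _ h
        omega
      · rintro ⟨b, hb, hba⟩
        have := hmin _ hb
        omega
  · rw [Finset.card_eq_zero, Finset.filter_eq_empty_iff]
    intro t ht hn
    simp only [rises, Finset.mem_filter] at ht
    push Not at hn
    have := hn 0 h
    exact ht.2.1 (by rwa [Nat.le_zero.1 this])

theorem card_rises_filter_final {n : ℕ} {A : Finset ℕ} (hA : A ⊆ Finset.range n)
    (hne : (Finset.range n \ A).Nonempty) :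
    ((rises A n).filter fun t => ¬∃ b ∈ Finset.range n \ A, t + 1 < b).card =
      if n - 1 ∈ A then 1 else 0 := by
  have hlt : ∀ a ∈ A, a < n := fun a ha => Finset.mem_range.1 (hA ha)
  obtain ⟨b, hb, hmax⟩ := Finset.exists_max_image _ id hne
  simp only [id, Finset.mem_sdiff, Finset.mem_range] at hmax hb
  split_ifs with h
  · have hbn : b ≠ n - 1 := fun h0 => hb.2 (h0 ▸ h)
    rw [Finset.card_eq_one]
    refine ⟨b, ?_⟩
    ext t
    simp only [rises, Finset.mem_filter, Finset.mem_range, Finset.mem_singleton,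
      Finset.mem_sdiff]
    constructor
    · rintro ⟨⟨htn, htA, ht⟩, hn⟩
      have h1 := hmax _ ⟨htn, htA⟩
      have h2 : ¬t + 1 < b := fun h => hn ⟨b, hb, h⟩
      have h3 : b ≠ t + 1 := fun h => hb.2 (h ▸ ht)
      omega
    · rintro rfl
      refine ⟨⟨hb.1, hb.2, ?_⟩, ?_⟩
      · by_contra hc
        have := hmax (t + 1) ⟨by omega, hc⟩
        omega
      · rintro ⟨c, hc, hcb⟩
        have := hmax _ hc
        omega
  · rw [Finset.card_eq_zero, Finset.filter_eq_empty_iff]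
    intro t ht hn
    simp only [rises, Finset.mem_filter] at ht
    refine hn ⟨n - 1, ?_, ?_⟩
    · simp only [Finset.mem_sdiff, Finset.mem_range]
      exact ⟨by omega, h⟩
    · have := hlt _ ht.2.2
      have : t + 1 ≠ n - 1 := fun h' => h (h' ▸ ht.2.2)
      omega

theorem card_rises_filter_initial_final {m n : ℕ} (hm : 1 ≤ m) (hmn : m < n) {A : Finset ℕ}
    (hA : A ∈ (Finset.range n).powersetCard m) :
    ((rises A n).filter fun t =>
      (¬∃ a ∈ A, a < t) ∧ ¬∃ b ∈ Finset.range n \ A, t + 1 < b).card =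
      if A = Finset.Ico (n - m) n then 1 else 0 := by
  rw [Finset.mem_powersetCard] at hA
  have hlt : ∀ a ∈ A, a < n := fun a ha => Finset.mem_range.1 (hA.1 ha)
  have key : ∀ t, t ∈ rises A n → (¬∃ a ∈ A, a < t) →
      (¬∃ b ∈ Finset.range n \ A, t + 1 < b) → A = Finset.Ico (n - m) n ∧ t = n - m - 1 := by
    intro t ht h1 h2
    simp only [rises, Finset.mem_filter, Finset.mem_range] at ht
    have hAt : A = Finset.Ico (t + 1) n := by
      ext x
      simp only [Finset.mem_Ico]
      constructor
      · intro hx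
        have : ¬x < t := fun h => h1 ⟨x, hx, h⟩
        have : x ≠ t := fun h => ht.2.1 (h ▸ hx)
        exact ⟨by omega, hlt x hx⟩
      · rintro ⟨hx1, hx2⟩
        rcases hx1.eq_or_lt with rfl | hx1
        · exact ht.2.2
        · by_contra hx
          exact h2 ⟨x, by simp [hx2, hx], hx1⟩
    have hc := hA.2
    rw [hAt, Nat.card_Ico] at hc
    have : t + 1 = n - m := by omega
    exact ⟨this ▸ hAt, by omega⟩
  split_ifs with h
  · rw [Finset.card_eq_one]
    refine ⟨n - m - 1, ?_⟩
    ext t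
    simp only [Finset.mem_filter, Finset.mem_singleton]
    constructor
    · rintro ⟨ht, h1, h2⟩
      exact (key t ht h1 h2).2
    · rintro rfl
      subst h
      simp only [rises, Finset.mem_filter, Finset.mem_range, Finset.mem_Ico, Finset.mem_sdiff]
      refine ⟨by omega, ?_, ?_⟩
      · rintro ⟨a, ha⟩
        omega
      · rintro ⟨a, ha⟩
        omega
  · rw [Finset.card_eq_zero, Finset.filter_eq_empty_iff]
    rintro t ht ⟨h1, h2⟩
    exact h (key t ht h1 h2).1

theorem sum_card_rises (m n : ℕ) :
    ∑ A ∈ (Finset.range n).powersetCard (m + 1), (rises A n).card =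
      (n - 1) * (n - 2).choose m := by
  have h : ∀ A ∈ (Finset.range n).powersetCard (m + 1),
      rises A n = (Finset.range (n - 1)).filter fun t => t ∉ A ∧ t + 1 ∈ A := by
    intro A hA
    ext t
    simp only [rises, Finset.mem_filter, Finset.mem_range]
    refine ⟨fun ⟨_, h2, h3⟩ => ⟨?_, h2, h3⟩, fun ⟨h1, h2⟩ => ⟨by omega, h2⟩⟩
    have := Finset.mem_range.1 ((Finset.mem_powersetCard.1 hA).1 h3)
    omega
  rw [Finset.sum_congr rfl fun A hA => congrArg Finset.card (h A hA)]
  simp only [Finset.card_filter]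
  rw [Finset.sum_comm]
  simp only [← Finset.card_filter]
  rw [Finset.sum_congr rfl fun t ht => card_powersetCard_notMem_mem (S := Finset.range n)
    (x := t) (y := t + 1) (by simp at ht ⊢; omega) (by simp at ht ⊢; omega) (by omega) m]
  simp

theorem sum_crossings_range {m : ℕ} (hm : 1 ≤ m) :
    (∑ A ∈ (Finset.range (2 * m)).powersetCard m,
        (crossings A (Finset.range (2 * m) \ A)).card) + (2 * m).choose m =
      (2 * m - 1) * (2 * m - 2).choose (m - 1) + 1 := by
  have hpt : ∀ A ∈ (Finset.range (2 * m)).powersetCard m,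
      (crossings A (Finset.range (2 * m) \ A)).card + (if 0 ∉ A then 1 else 0) +
        (if 2 * m - 1 ∈ A then 1 else 0) =
      (rises A (2 * m)).card + if A = Finset.Ico (2 * m - m) (2 * m) then 1 else 0 := by
    intro A hA
    have hA' := Finset.mem_powersetCard.1 hA
    have hne : A.Nonempty := Finset.card_pos.1 (by omega)
    have hne' : (Finset.range (2 * m) \ A).Nonempty := Finset.card_pos.1 (by
      rw [Finset.card_sdiff_of_subset hA'.1, Finset.card_range]; omega)
    rw [← card_rises_filter_initial hA'.1 hne, ← card_rises_filter_final hA'.1 hne',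
      ← card_rises_filter_initial_final hm (by omega) hA, card_crossings_range]
    convert card_filter_and_add_card_filter_not (rises A (2 * m)) (fun t => ∃ a ∈ A, a < t)
      fun t => ∃ b ∈ Finset.range (2 * m) \ A, t + 1 < b
  have hsum := Finset.sum_congr rfl hpt
  simp only [Finset.sum_add_distrib] at hsum
  rw [← Finset.card_filter, ← Finset.card_filter, Finset.sum_ite_eq',
    if_pos (by
      rw [Finset.mem_powersetCard, Nat.card_Ico]
      refine ⟨fun x hx => ?_, by omega⟩
      simp only [Finset.mem_Ico, Finset.mem_range] at hx ⊢
      omega), card_powersetCard_notMem (by simp; omega)] at hsum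
  have hlast := Finset.card_filter_add_card_filter_not
    (s := (Finset.range (2 * m)).powersetCard m) (2 * m - 1 ∈ ·)
  rw [card_powersetCard_notMem (by simp; omega), Finset.card_powersetCard] at hlast
  obtain ⟨m, rfl⟩ := Nat.exists_eq_add_of_le' hm
  rw [sum_card_rises] at hsum
  rw [Finset.card_range] at *
  simp only [Nat.add_sub_cancel] at *
  omega

theorem two_mul_choose_central {m : ℕ} (hm : 1 ≤ m) :
    2 * ((2 * m - 1) * (2 * m - 2).choose (m - 1)) = m * (2 * m).choose m := by
  obtain ⟨m, rfl⟩ := Nat.exists_eq_add_of_le' hm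
  have h := Nat.succ_mul_centralBinom_succ m
  simp only [Nat.centralBinom] at h
  have e : 2 * (m + 1) - 2 = 2 * m := by omega
  have e' : 2 * (m + 1) - 1 = 2 * m + 1 := by omega
  rw [h, e, e', Nat.add_sub_cancel]
  ring

/-- The average of the number of ordered crossings between a random `m`-subset of a `2m`-set and
its complement. -/
theorem sum_crossings_sub {m : ℕ} (hm : 1 ≤ m) {U : Finset ℕ} (hU : U.card = 2 * m) :
    ∑ A ∈ U.powersetCard m,
      (((crossings A (U \ A)).card : ℚ) - ((m : ℚ) - 2 + 2 / ((2 * m).choose m : ℚ)) / 2) = 0 := by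
  have h := sum_crossings_range hm
  have h' := two_mul_choose_central hm
  rw [← hU, ← sum_crossings_eq_range m U, hU] at h
  rw [Finset.sum_sub_distrib, Finset.sum_const, Finset.card_powersetCard, hU, nsmul_eq_mul,
    ← Nat.cast_sum]
  have hpos : ((2 * m).choose m : ℚ) ≠ 0 := by
    exact_mod_cast (Nat.choose_pos (by omega)).ne'
  generalize ∑ A ∈ U.powersetCard m, (crossings A (U \ A)).card = s at *
  generalize (2 * m - 1) * (2 * m - 2).choose (m - 1) = r at *
  have h1 : (s : ℚ) + (2 * m).choose m = r + 1 := by exact_mod_cast h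
  have h2 : 2 * (r : ℚ) = m * (2 * m).choose m := by exact_mod_cast h'
  field_simp
  linarith

theorem mem_partitionsUniform {m k : ℕ} {P : Finset (Finset ℕ)} :
    P ∈ partitionsUniform m k ↔
      IsPartition P (seg (m * k)) ∧ P.card = k ∧ ∀ B ∈ P, B.card = m := by
  simp only [partitionsUniform, partitions, Finset.mem_filter, Finset.mem_powerset,
    and_iff_right_iff_imp, and_assoc]
  rintro ⟨h, -⟩ B hB
  rw [Finset.mem_powerset, ← h.2.2]
  exact Finset.subset_biUnion_of_mem id hB

theorem partitionsUniform_nonempty {m : ℕ} (hm : 1 ≤ m) (k : ℕ) :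
    (partitionsUniform m k).Nonempty := by
  have hdisj : ∀ i j, i < j →
      Disjoint (Finset.Ioc (m * i) (m * (i + 1))) (Finset.Ioc (m * j) (m * (j + 1))) := by
    intro i j hij
    rw [Finset.disjoint_left]
    intro x hx hx'
    rw [Finset.mem_Ioc] at hx hx'
    have := Nat.mul_le_mul_left m (Nat.succ_le_of_lt hij)
    simp only [Nat.succ_eq_add_one] at this
    omega
  have hne : ∀ i, (Finset.Ioc (m * i) (m * (i + 1))).Nonempty := fun i => by
    rw [Finset.nonempty_Ioc, mul_add]
    omega
  have hdisj' : ∀ i j, i ≠ j →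
      Disjoint (Finset.Ioc (m * i) (m * (i + 1))) (Finset.Ioc (m * j) (m * (j + 1))) :=
    fun i j hij => hij.lt_or_gt.elim (hdisj i j) fun h => (hdisj j i h).symm
  have hinj : Function.Injective fun i => Finset.Ioc (m * i) (m * (i + 1)) := by
    intro i j hij
    by_contra h
    have := hdisj' i j h
    simp only at hij
    rw [hij, disjoint_self] at this
    exact (hne j).ne_empty this
  refine ⟨(Finset.range k).image fun i => Finset.Ioc (m * i) (m * (i + 1)), ?_⟩
  rw [mem_partitionsUniform]
  refine ⟨⟨?_, ?_, ?_⟩, ?_, ?_⟩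
  · intro h
    obtain ⟨i, -, hi⟩ := Finset.mem_image.1 h
    exact (hne i).ne_empty hi
  · intro B hB C hC hBC
    obtain ⟨i, -, rfl⟩ := Finset.mem_image.1 hB
    obtain ⟨j, -, rfl⟩ := Finset.mem_image.1 hC
    exact hdisj' i j fun h => hBC (by rw [h])
  · ext x
    simp only [Finset.mem_biUnion, Finset.mem_image, Finset.mem_range, seg, Finset.mem_Icc, id]
    constructor
    · rintro ⟨_, ⟨i, hi, rfl⟩, hx⟩
      rw [Finset.mem_Ioc] at hx
      have := Nat.mul_le_mul_left m (Nat.succ_le_of_lt hi)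
      simp only [Nat.succ_eq_add_one] at this
      omega
    · rintro ⟨h1, h2⟩
      refine ⟨_, ⟨(x - 1) / m, ?_, rfl⟩, ?_⟩
      · rw [Nat.div_lt_iff_lt_mul hm, mul_comm]
        omega
      · have h3 := Nat.div_add_mod (x - 1) m
        have h4 := Nat.mod_lt (x - 1) hm
        rw [Finset.mem_Ioc, mul_add]
        omega
  · rw [Finset.card_image_of_injective _ hinj, Finset.card_range]
  · intro B hB
    obtain ⟨i, -, rfl⟩ := Finset.mem_image.1 hB
    rw [Nat.card_Ioc, mul_add]
    omega

theorem crol_eq_sum_crossings {P : Finset (Finset ℕ)} {S : Finset ℕ} (hP : IsPartition P S) :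
    crol P = ∑ q ∈ P.offDiag, (crossings q.1 q.2).card := by
  have huniq : ∀ B ∈ P, ∀ C ∈ P, ∀ x, x ∈ B → x ∈ C → B = C := by
    intro B hB C hC x hxB hxC
    by_contra h
    exact Finset.disjoint_left.1 (hP.2.1 B hB C hC h) hxB hxC
  rw [← Finset.card_biUnion]
  · rw [crol]
    refine Nat.subtype_card _ ?_
    rintro ⟨⟨a, b⟩, c, d⟩
    simp only [Finset.mem_biUnion, Finset.mem_offDiag, mem_crossings, IsEdge, Prod.exists]
    constructor
    · rintro ⟨A, B, ⟨hA, hB, hAB⟩, ⟨⟨ha, hb⟩, hc, hd⟩, h1, h2, h3, h4, h5⟩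
      exact ⟨⟨h3.trans h4, A, hA, ha, hb, h1⟩, ⟨h4.trans h5, B, hB, hc, hd, h2⟩, h3, h4, h5⟩
    · rintro ⟨⟨-, A, hA, ha, hb, h1⟩, ⟨-, B, hB, hc, hd, h2⟩, h3, h4, h5⟩
      refine ⟨A, B, ⟨hA, hB, ?_⟩, ⟨⟨ha, hb⟩, hc, hd⟩, h1, h2, h3, h4, h5⟩
      rintro rfl
      exact h1 c hc ⟨h3, h4⟩
  · rintro ⟨A, B⟩ hq ⟨A', B'⟩ hq' hne
    rw [Finset.mem_coe, Finset.mem_offDiag] at hq hq'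
    change Disjoint _ _
    rw [Finset.disjoint_left]
    rintro e he he'
    rw [mem_crossings] at he he'
    exact hne (Prod.ext (huniq _ hq.1 _ hq'.1 _ he.1.1.1 he'.1.1.1)
      (huniq _ hq.2.1 _ hq'.2.1 _ he.1.2.1 he'.1.2.1))

/-- Replacing two blocks of a uniform partition by another splitting of their union into equal
parts gives a uniform partition. -/
theorem union_pair_mem_partitionsUniform {m k : ℕ} (hm : 1 ≤ m) {P : Finset (Finset ℕ)}
    (hP : P ∈ partitionsUniform m k) {A B A' B' : Finset ℕ} (hA : A ∈ P) (hB : B ∈ P)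
    (hAB : A ≠ B) (hdisj : Disjoint A' B') (hunion : A' ∪ B' = A ∪ B) (hA' : A'.card = m)
    (hB' : B'.card = m) :
    P \ {A, B} ∪ {A', B'} ∈ partitionsUniform m k ∧
      (P \ {A, B} ∪ {A', B'}) \ {A', B'} = P \ {A, B} := by
  rw [mem_partitionsUniform] at hP
  obtain ⟨⟨h0, hd, hU⟩, hcard, hsize⟩ := hP
  have hR : ∀ C ∈ P \ {A, B}, Disjoint C (A' ∪ B') := by
    intro C hC
    simp only [Finset.mem_sdiff, Finset.mem_insert, Finset.mem_singleton, not_or] at hC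
    rw [hunion, Finset.disjoint_union_right]
    exact ⟨hd C hC.1 A hA hC.2.1, hd C hC.1 B hB hC.2.2⟩
  have hRA : ∀ C ∈ P \ {A, B}, Disjoint C A' := fun C hC =>
    (Finset.disjoint_union_right.1 (hR C hC)).1
  have hRB : ∀ C ∈ P \ {A, B}, Disjoint C B' := fun C hC =>
    (Finset.disjoint_union_right.1 (hR C hC)).2
  have hneA : A' ≠ ∅ := by rintro rfl; simp at hA'; omega
  have hneB : B' ≠ ∅ := by rintro rfl; simp at hB'; omega
  have hneAB : A' ≠ B' := by
    rintro rfl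
    exact hneA (disjoint_self.1 hdisj)
  have hdisjR : Disjoint (P \ {A, B}) {A', B'} := by
    rw [Finset.disjoint_left]
    intro C hC hC'
    rw [Finset.mem_insert, Finset.mem_singleton] at hC'
    rcases hC' with rfl | rfl
    · exact hneA (disjoint_self.1 (hRA _ hC))
    · exact hneB (disjoint_self.1 (hRB _ hC))
  have hsub : {A, B} ⊆ P := by
    simp [Finset.insert_subset_iff, hA, hB]
  refine ⟨?_, ?_⟩
  · rw [mem_partitionsUniform]
    refine ⟨⟨?_, ?_, ?_⟩, ?_, ?_⟩
    · simp only [Finset.mem_union, Finset.mem_sdiff, Finset.mem_insert, Finset.mem_singleton]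
      rintro (h | h | h)
      · exact h0 h.1
      · exact hneA h.symm
      · exact hneB h.symm
    · intro C hC D hD hCD
      rw [Finset.mem_union, Finset.mem_insert, Finset.mem_singleton] at hC hD
      rcases hC with hC | rfl | rfl <;> rcases hD with hD | rfl | rfl
      · exact hd C (Finset.mem_sdiff.1 hC).1 D (Finset.mem_sdiff.1 hD).1 hCD
      · exact hRA C hC
      · exact hRB C hC
      · exact (hRA D hD).symm
      · exact absurd rfl hCD
      · exact hdisj
      · exact (hRB D hD).symm
      · exact hdisj.symm
      · exact absurd rfl hCD
    · rw [← hU, ← Finset.sdiff_union_of_subset hsub, Finset.union_biUnion, Finset.union_biUnion,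
        Finset.sdiff_union_of_subset hsub]
      congr 1
      simpa [Finset.biUnion_insert] using hunion
    · rw [Finset.card_union_of_disjoint hdisjR, Finset.card_sdiff_of_subset hsub,
        Finset.card_pair hAB, Finset.card_pair hneAB, ← hcard]
      have := Finset.card_le_card hsub
      rw [Finset.card_pair hAB] at this
      omega
    · intro C hC
      rw [Finset.mem_union, Finset.mem_insert, Finset.mem_singleton] at hC
      rcases hC with hC | rfl | rfl
      · exact hsize C (Finset.mem_sdiff.1 hC).1
      · exact hA'
      · exact hB'
  · rw [Finset.union_sdiff_right, Finset.sdiff_eq_self_of_disjoint hdisjR]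

/-- A function of ordered pairs of blocks whose sum over the splittings of any `2m`-set into two
`m`-sets vanishes also has vanishing sum over all pairs of distinct blocks of all uniform
partitions. -/
theorem sum_offDiag_eq_zero {m k : ℕ} (hm : 1 ≤ m) (g : Finset ℕ → Finset ℕ → ℚ)
    (hg : ∀ U : Finset ℕ, U.card = 2 * m → ∑ A ∈ U.powersetCard m, g A (U \ A) = 0) :
    ∑ P ∈ partitionsUniform m k, ∑ q ∈ P.offDiag, g q.1 q.2 = 0 := by
  rw [Finset.sum_sigma']
  set X := (partitionsUniform m k).sigma fun P => P.offDiag with hX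
  let key : (Σ _ : Finset (Finset ℕ), Finset ℕ × Finset ℕ) → Finset ℕ × Finset (Finset ℕ) :=
    fun x => (x.2.1 ∪ x.2.2, x.1 \ {x.2.1, x.2.2})
  rw [← Finset.sum_fiberwise_of_maps_to (t := X.image key) (g := key)
    fun x hx => Finset.mem_image_of_mem _ hx]
  refine Finset.sum_eq_zero fun K hK => ?_
  obtain ⟨⟨P, A, B⟩, hx, rfl⟩ := Finset.mem_image.1 hK
  rw [hX, Finset.mem_sigma, Finset.mem_offDiag] at hx
  obtain ⟨hP, hA, hB, hAB⟩ := hx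
  simp only at hP hA hB hAB
  have hP' := mem_partitionsUniform.1 hP
  have hU : (A ∪ B).card = 2 * m := by
    rw [Finset.card_union_of_disjoint (hP'.1.2.1 A hA B hB hAB), hP'.2.2 A hA, hP'.2.2 B hB]
    omega
  rw [← hg _ hU]
  symm
  refine Finset.sum_bij' (fun A' _ => ⟨P \ {A, B} ∪ {A', (A ∪ B) \ A'}, A', (A ∪ B) \ A'⟩)
    (fun x _ => x.2.1) ?_ ?_ ?_ ?_ ?_
  · intro A' hA'
    rw [Finset.mem_powersetCard] at hA'
    have hun : A' ∪ (A ∪ B) \ A' = A ∪ B := Finset.union_sdiff_of_subset hA'.1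
    have hcard : ((A ∪ B) \ A').card = m := by
      rw [Finset.card_sdiff_of_subset hA'.1]
      omega
    have h := union_pair_mem_partitionsUniform hm hP hA hB hAB Finset.disjoint_sdiff hun hA'.2
      hcard
    rw [Finset.mem_filter, hX, Finset.mem_sigma, Finset.mem_offDiag]
    refine ⟨⟨h.1, by simp, by simp, ?_⟩, ?_⟩
    · intro heq
      simp only at heq
      have hd : Disjoint A' ((A ∪ B) \ A') := Finset.disjoint_sdiff
      rw [← heq, disjoint_self] at hd
      rw [hd] at hA'
      simp at hA'
      omega
    · exact Prod.ext hun h.2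
  · rintro ⟨P', A', B'⟩ hx
    rw [Finset.mem_filter, hX, Finset.mem_sigma, Finset.mem_offDiag] at hx
    obtain ⟨⟨hP', hA', hB', hAB'⟩, hk⟩ := hx
    rw [Finset.mem_powersetCard]
    refine ⟨?_, (mem_partitionsUniform.1 hP').2.2 _ hA'⟩
    have hk' : A' ∪ B' = A ∪ B := (Prod.ext_iff.1 hk).1
    exact hk' ▸ Finset.subset_union_left
  · exact fun _ _ => rfl
  · rintro ⟨P', A', B'⟩ hx
    rw [Finset.mem_filter, hX, Finset.mem_sigma, Finset.mem_offDiag] at hx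
    obtain ⟨⟨hP', hA', hB', hAB'⟩, hk⟩ := hx
    simp only [key, Prod.mk.injEq] at hk hP' hA' hB' hAB'
    have hd := (mem_partitionsUniform.1 hP').1.2.1 _ hA' _ hB' hAB'
    have hB'' : (A ∪ B) \ A' = B' := by
      rw [← hk.1, Finset.union_sdiff_cancel_left hd]
    have hsub : {A', B'} ⊆ P' := by
      simp [Finset.insert_subset_iff, hA', hB']
    simp only [hB'', ← hk.2, Finset.sdiff_union_of_subset hsub]
  · exact fun _ _ => rfl

theorem sum_crol_partitionsUniform {m : ℕ} (hm : 1 ≤ m) (k : ℕ) :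
    ∑ π ∈ partitionsUniform m k, (crol π : ℚ) =
      (k.choose 2 : ℚ) * ((m : ℚ) - 2 + 2 / ((2 * m).choose m : ℚ)) *
        ((partitionsUniform m k).card : ℚ) := by
  set c : ℚ := (m : ℚ) - 2 + 2 / ((2 * m).choose m : ℚ) with hc
  have h := sum_offDiag_eq_zero (k := k) hm (fun A B => ((crossings A B).card : ℚ) - c / 2)
    fun U hU => sum_crossings_sub hm hU
  have hpt : ∀ P ∈ partitionsUniform m k,
      ∑ q ∈ P.offDiag, (((crossings q.1 q.2).card : ℚ) - c / 2) = crol P - k.choose 2 * c := by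
    intro P hP
    rw [mem_partitionsUniform] at hP
    have hk : ((k * k - k : ℕ) : ℚ) = (k : ℚ) * k - k := by
      rw [Nat.cast_sub (Nat.le_mul_self k), Nat.cast_mul]
    rw [crol_eq_sum_crossings hP.1, Finset.sum_sub_distrib, Finset.sum_const,
      Finset.offDiag_card, hP.2.1, nsmul_eq_mul, hk, Nat.cast_choose_two, Nat.cast_sum]
    ring
  rw [Finset.sum_congr rfl hpt, Finset.sum_sub_distrib, Finset.sum_const, nsmul_eq_mul] at h
  linarith

/-- average number of linear crossings in a random partition into `k`
blocks of size `m`. -/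
theorem crol_mean_uniform_blocks (m k : ℕ) (hm : 1 ≤ m) (hk : 1 ≤ k) :
    (∑ π ∈ partitionsUniform m k, (crol π : ℚ)) / ((partitionsUniform m k).card : ℚ)
        = (k.choose 2 : ℚ) * ((m : ℚ) - 2 + 2 / ((2*m).choose m : ℚ)) ∧
    (∑ π ∈ partitionsUniform m k, (crol π : ℚ))
        = (k.choose 2 : ℚ) * ((m : ℚ) - 2 + 2 / ((2*m).choose m : ℚ))
            * ((partitionsUniform m k).card : ℚ) := by
  have hne : ((partitionsUniform m k).card : ℚ) ≠ 0 := by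
    exact_mod_cast (Finset.card_pos.2 (partitionsUniform_nonempty hm k)).ne'
  exact ⟨by rw [sum_crol_partitionsUniform hm k, mul_div_cancel_right₀ _ hne],
    sum_crol_partitionsUniform hm k⟩
end
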